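/- Let (A_S,S) be an Artin-Tits system of spherical type, X ⊆ S indecomposable, t ∈ X, and g a positive Y-ribbon-X for some Y ⊆ S. If t right-divides g in A_S⁺, then Δ_X right-divides g in A_S⁺. -/

import Mathlib

/-!
Common definitions for formalizing "Normalisateur des sous-groupes paraboliques
des groupes d'Artin-Tits" (E. Godelle).

We fix a Coxeter matrix `M` over a finite index set `B` (Mathlib's convention:
`M s t = 0` encodes `m_{s,t} = ∞`).  The Artin-Tits group `Artin M` is the
presented group on the braid relations, the Coxeter group is Mathlib's
`M.Group`, and `proj : Artin M →* M.Group` is the canonical projection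
(adding the relations `s² = 1`).
-/

namespace ArtinTitsPaper

open List

variable {B : Type*}

/-- The alternating list `[s, t, s, t, ...]` with `n` terms, starting with `s`. -/
def altList (s t : B) : ℕ → List B
  | 0 => []
  | n + 1 => s :: altList t s n

/-- The braid relators `(sts⋯)(tst⋯)⁻¹` (`m_{s,t}` letters each) for `s ≠ t`,
`m_{s,t} ≠ ∞`. -/
def braidRels (M : CoxeterMatrix B) : Set (FreeGroup B) :=
  { r | ∃ s t : B, s ≠ t ∧ M s t ≠ 0 ∧
      r = ((altList s t (M s t)).map FreeGroup.of).prod *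
          (((altList t s (M s t)).map FreeGroup.of).prod)⁻¹ }

/-- The Artin-Tits group associated to the Coxeter matrix `M`. -/
def Artin (M : CoxeterMatrix B) : Type _ := PresentedGroup (braidRels M)

instance (M : CoxeterMatrix B) : Group (Artin M) :=
  QuotientGroup.Quotient.group _

/-- The standard generator of `Artin M` indexed by `s : B` (the image of `S` in `A_S`). -/
def gen (M : CoxeterMatrix B) (s : B) : Artin M := PresentedGroup.of s

theorem altList_eq_reverse_alternatingWord (s t : B) (n : ℕ) :
    altList s t n = (CoxeterSystem.alternatingWord t s n).reverse := by
  induction n generalizing s t with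
  | zero => rfl
  | succ n ih =>
      rw [altList, CoxeterSystem.alternatingWord_succ, List.concat_eq_append,
        List.reverse_append]
      simp [ih]

theorem lift_simple_listProd (M : CoxeterMatrix B) (l : List B) :
    FreeGroup.lift M.simple ((l.map FreeGroup.of).prod) =
      M.toCoxeterSystem.wordProd l := by
  rw [CoxeterSystem.wordProd, map_list_prod, List.map_map]
  simp [Function.comp_def, CoxeterMatrix.toCoxeterSystem_simple]

theorem braid_lift (M : CoxeterMatrix B) :
    ∀ r ∈ braidRels M, FreeGroup.lift M.simple r = 1 := by
  rintro r ⟨s, t, hst, hm, rfl⟩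
  rw [map_mul, map_inv, lift_simple_listProd, lift_simple_listProd,
    altList_eq_reverse_alternatingWord, altList_eq_reverse_alternatingWord,
    CoxeterSystem.wordProd_reverse, CoxeterSystem.wordProd_reverse]
  have hsym : M s t = M t s := M.symmetric s t
  have hb := M.toCoxeterSystem.wordProd_braidWord_eq t s
  rw [CoxeterSystem.braidWord, CoxeterSystem.braidWord, ← hsym] at hb
  rw [hb]
  simp

/-- The canonical projection from the Artin-Tits group onto the Coxeter group
(adding the relations `s² = 1`). -/
def proj (M : CoxeterMatrix B) : Artin M →* M.Group :=
  PresentedGroup.toGroup (braid_lift M)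

/-- The positive monoid `A_S⁺`, the submonoid of `A_S` generated by `S`. -/
def posMon (M : CoxeterMatrix B) : Submonoid (Artin M) :=
  Submonoid.closure (Set.range (gen M))

/-- The submonoid `A_X⁺` of `A_S` generated by `X ⊆ S`. -/
def posMonOn (M : CoxeterMatrix B) (X : Set B) : Submonoid (Artin M) :=
  Submonoid.closure (gen M '' X)

/-- The standard parabolic subgroup `A_X` of `A_S` generated by `X ⊆ S`. -/
def stdSub (M : CoxeterMatrix B) (X : Set B) : Subgroup (Artin M) :=
  Subgroup.closure (gen M '' X)

/-- The standard parabolic subgroup `W_X` of the Coxeter group `W_S`. -/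
def coxSub (M : CoxeterMatrix B) (X : Set B) : Subgroup M.Group :=
  Subgroup.closure (M.simple '' X)

/-- `X ⊆ S` is of spherical type if the Coxeter group `W_X` is finite. -/
def IsSpherical (M : CoxeterMatrix B) (X : Set B) : Prop :=
  Finite (coxSub M X)

/-- `a` left-divides `b` in the positive monoid: `b = a c` with `c ∈ A_S⁺`. -/
def ldvd (M : CoxeterMatrix B) (a b : Artin M) : Prop :=
  ∃ c ∈ posMon M, a * c = b

/-- `a` right-divides `b` in the positive monoid: `b = c a` with `c ∈ A_S⁺`. -/
def rdvd (M : CoxeterMatrix B) (a b : Artin M) : Prop :=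
  ∃ c ∈ posMon M, c * a = b

/-- `d` is the least common multiple `Δ_X` of `X` in `A_X⁺` (for left-divisibility). -/
def IsDelta (M : CoxeterMatrix B) (X : Set B) (d : Artin M) : Prop :=
  d ∈ posMonOn M X ∧
  (∀ s ∈ X, ∃ c ∈ posMonOn M X, gen M s * c = d) ∧
  ∀ m ∈ posMonOn M X, (∀ s ∈ X, ∃ c ∈ posMonOn M X, gen M s * c = m) →
    ∃ c ∈ posMonOn M X, d * c = m

/-- The subset `Xg = {σ_x g : x ∈ X}` of `A_S`. -/
def leftMul (M : CoxeterMatrix B) (X : Set B) (g : Artin M) : Set (Artin M) :=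
  (fun x => gen M x * g) '' X

/-- The subset `gX = {g σ_x : x ∈ X}` of `A_S`. -/
def rightMul (M : CoxeterMatrix B) (X : Set B) (g : Artin M) : Set (Artin M) :=
  (fun x => g * gen M x) '' X

/-- `Conj(S;X,Y) = {g ∈ A_S : gX = Yg}`. -/
def conjSet (M : CoxeterMatrix B) (X Y : Set B) : Set (Artin M) :=
  { g | rightMul M X g = leftMul M Y g }

/-- `Conj⁺(S;X,Y) = {g ∈ A_S⁺ : gX = Yg}`. -/
def conjPos (M : CoxeterMatrix B) (X Y : Set B) : Set (Artin M) :=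
  { g | g ∈ posMon M ∧ rightMul M X g = leftMul M Y g }

/-- The quasi-centralizer `QZ_{A_S}(A_X) = {g ∈ A_S : gX = Xg}`. -/
def QZset (M : CoxeterMatrix B) (X : Set B) : Set (Artin M) :=
  conjSet M X X

/-- The indecomposable component of `Z` containing `t` (vertices of `Z` joined to `t`
by a path of edges `m_{a,b} ≠ 2` in the Coxeter diagram on `Z`). -/
def comp (M : CoxeterMatrix B) (Z : Set B) (t : B) : Set B :=
  { s ∈ Z | Relation.ReflTransGen (fun a b => a ∈ Z ∧ b ∈ Z ∧ a ≠ b ∧ M a b ≠ 2) t s }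

/-- `Z` is indecomposable: it admits no nontrivial partition `Z = Z₁ ∪ Z₂` with
`m_{a,b} = 2` for `a ∈ Z₁`, `b ∈ Z₂`. -/
def Indecomp (M : CoxeterMatrix B) (Z : Set B) : Prop :=
  ¬ ∃ Z₁ Z₂ : Set B, Z₁.Nonempty ∧ Z₂.Nonempty ∧ Z₁ ∪ Z₂ = Z ∧ Disjoint Z₁ Z₂ ∧
      ∀ a ∈ Z₁, ∀ b ∈ Z₂, M a b = 2

/-- `g` is an elementary positive `Y`-ribbon-`X`: `g = d_{X,t}` for some `t ∈ S` with
`X(t)` of spherical type, where `d_{X,t} = Δ_{X(t)}` if `t ∈ X` and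
`d_{X,t} = Δ_{X(t)} Δ_{X(t)∖{t}}⁻¹` otherwise, and `Y ⊆ X ∪ {t}` satisfies `Yg = gX`. -/
def IsElemRibbon (M : CoxeterMatrix B) (X Y : Set B) (g : Artin M) : Prop :=
  ∃ t : B, IsSpherical M (comp M (X ∪ {t}) t) ∧
    ((t ∈ X ∧ IsDelta M (comp M (X ∪ {t}) t) g) ∨
      (t ∉ X ∧ ∃ d₁ d₂ : Artin M, IsDelta M (comp M (X ∪ {t}) t) d₁ ∧
        IsDelta M ((comp M (X ∪ {t}) t) \ {t}) d₂ ∧ g = d₁ * d₂⁻¹)) ∧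
    Y ⊆ X ∪ {t} ∧ leftMul M Y g = rightMul M X g

/-- `g` is a positive `Y`-ribbon-`X`: a product `g = g_n ⋯ g_1` of elementary positive
`X_i`-ribbons-`X_{i-1}` with `X_0 = X`, `X_n = Y`. -/
inductive IsRibbon (M : CoxeterMatrix B) : Set B → Set B → Artin M → Prop
  | nil (X : Set B) : IsRibbon M X X 1
  | cons {X Y Z : Set B} {g h : Artin M} :
      IsRibbon M X Y g → IsElemRibbon M Y Z h → IsRibbon M X Z (h * g)

/-- `g` is `X`-reduced: no element of `X` left-divides `g`. -/
def lreduced (M : CoxeterMatrix B) (X : Set B) (g : Artin M) : Prop :=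
  ∀ s ∈ X, ¬ ldvd M (gen M s) g

/-- `g` is reduced-`X`: no element of `X` right-divides `g`. -/
def rreduced (M : CoxeterMatrix B) (X : Set B) (g : Artin M) : Prop :=
  ∀ s ∈ X, ¬ rdvd M (gen M s) g

/-- The set `H_X` of elements `g₁ g₂⁻¹` where `g₁, g₂` are `X`-reduced positive
`X`-ribbons-`X`. -/
def HXset (M : CoxeterMatrix B) (X : Set B) : Set (Artin M) :=
  { g | ∃ g₁ g₂ : Artin M, IsRibbon M X X g₁ ∧ lreduced M X g₁ ∧
      IsRibbon M X X g₂ ∧ lreduced M X g₂ ∧ g = g₁ * g₂⁻¹ }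

/-- The length of a positive element (the common length of its expressions as words
in the generators; junk value `0` outside of `A_S⁺`). -/
noncomputable def len (M : CoxeterMatrix B) (g : Artin M) : ℕ :=
  sInf { n | ∃ l : List B, l.length = n ∧ (l.map (gen M)).prod = g }

/-- The length of an element of the Coxeter group `W_S`. -/
noncomputable def wlen (M : CoxeterMatrix B) (w : M.Group) : ℕ :=
  sInf { n | ∃ l : List B, l.length = n ∧ (l.map M.simple).prod = w }

/-- `g ∈ A_{S,red}`: `g` is positive and has the same length as its image in `W_S`. -/
def Red (M : CoxeterMatrix B) (g : Artin M) : Prop :=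
  g ∈ posMon M ∧ len M g = wlen M (proj M g)

/-- `C` is a simple `s`-chain-`u`: either `C = 1` and `s = u`, or
`C = tst⋯` (`k` letters, `k < m_{s,t}`) with `u ∈ {s,t}` and `C·u = tst⋯` (`k+1` letters). -/
def IsSimpleChain (M : CoxeterMatrix B) (s u : B) (C : Artin M) : Prop :=
  (C = 1 ∧ s = u) ∨
  ∃ t : B, t ≠ s ∧ (u = s ∨ u = t) ∧ ∃ k : ℕ,
    (M s t = 0 ∨ k < M s t) ∧
    C = ((altList t s k).map (gen M)).prod ∧
    C * gen M u = ((altList t s (k + 1)).map (gen M)).prod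

/-- `C` is an `s`-chain-`t`: a product `C₁ ⋯ C_k` of simple chains composing from
origin `s` to target `t`. -/
inductive IsChain (M : CoxeterMatrix B) : B → B → Artin M → Prop
  | single {s u : B} {C : Artin M} : IsSimpleChain M s u C → IsChain M s u C
  | comp {s u v : B} {C D : Artin M} :
      IsChain M s u C → IsSimpleChain M u v D → IsChain M s v (C * D)

/-! ### Orders of products of two simple reflections -/

section GeometricRepresentation

open Polynomial.Chebyshev

theorem chebyshev_S_add_eq_zero {m : ℕ} (hm : 3 ≤ m) {a b : ℤ} (hab : a + b + 2 = m) :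
    (S ℝ a).eval (2 * Real.cos (2 * (Real.pi / m))) +
      (S ℝ b).eval (2 * Real.cos (2 * (Real.pi / m))) = 0 := by
  have hm0 : (m : ℝ) ≠ 0 := by positivity
  have hm3 : (3 : ℝ) ≤ m := by exact_mod_cast hm
  have hsin : Real.sin (2 * (Real.pi / m)) ≠ 0 := by
    refine (Real.sin_pos_of_pos_of_lt_pi (by positivity) ?_).ne'
    rw [← mul_div_assoc, div_lt_iff₀ (by positivity)]
    nlinarith [Real.pi_pos]
  apply mul_right_cancel₀ hsin
  rw [add_mul, S_two_mul_real_cos, S_two_mul_real_cos, zero_mul]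
  have hb : (b : ℝ) = m - a - 2 := by
    have : (a : ℝ) + b + 2 = m := by exact_mod_cast hab
    linarith
  have : ((b : ℝ) + 1) * (2 * (Real.pi / m)) =
      2 * Real.pi - ((a : ℝ) + 1) * (2 * (Real.pi / m)) := by
    rw [hb]; field_simp; ring
  rw [this, Real.sin_two_pi_sub]
  ring

theorem chebyshev_S_half_eq_zero {m : ℕ} (hm : 3 ≤ m) {a : ℤ} (ha : 2 * a + 2 = m) :
    (S ℝ a).eval (2 * Real.cos (2 * (Real.pi / m))) = 0 := by
  have := chebyshev_S_add_eq_zero hm (a := a) (b := a) (by omega)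
  linarith

/-- The coefficient `2 B(e_s, e_t)` of the canonical bilinear form of a Coxeter matrix. -/
noncomputable def geomCoeff (M : CoxeterMatrix B) (s t : B) : ℝ :=
  -2 * Real.cos (Real.pi / M s t)

theorem geomCoeff_comm (M : CoxeterMatrix B) (s t : B) : geomCoeff M s t = geomCoeff M t s := by
  rw [geomCoeff, geomCoeff, M.symmetric]

theorem geomCoeff_mul_sub_two (M : CoxeterMatrix B) (s t : B) :
    geomCoeff M s t * geomCoeff M t s - 2 = 2 * Real.cos (2 * (Real.pi / M s t)) := by
  rw [geomCoeff_comm M t s, geomCoeff, Real.cos_two_mul]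
  ring

/-- The coroot `2 B(e_s, ·)` of the canonical bilinear form. -/
noncomputable def geomCoroot (M : CoxeterMatrix B) (s : B) : Module.Dual ℝ (B →₀ ℝ) :=
  Finsupp.linearCombination ℝ (geomCoeff M s)

theorem geomCoroot_single (M : CoxeterMatrix B) (s t : B) :
    geomCoroot M s (Finsupp.single t 1) = geomCoeff M s t := by
  simp [geomCoroot]

theorem geomCoroot_self (M : CoxeterMatrix B) (s : B) :
    geomCoroot M s (Finsupp.single s 1) = 2 := by
  simp [geomCoroot_single, geomCoeff]

theorem geomCoeff_eq_zero (M : CoxeterMatrix B) {s t : B} (h : M s t = 2) :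
    geomCoeff M s t = 0 := by
  simp [geomCoeff, h]

/-- The simple reflections of the geometric representation. -/
noncomputable def geomReflection (M : CoxeterMatrix B) (s : B) :
    (B →₀ ℝ) ≃ₗ[ℝ] (B →₀ ℝ) :=
  Module.reflection (geomCoroot_self M s)

theorem geomReflection_isLiftable (M : CoxeterMatrix B) : M.IsLiftable (geomReflection M) := by
  intro s t
  apply LinearEquiv.toLinearMap_injective
  rcases eq_or_ne s t with rfl | hst
  · refine LinearMap.ext fun x => ?_
    rw [M.diagonal, pow_one]
    exact Module.involutive_reflection (geomCoroot_self M s) x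
  have hm1 : M s t ≠ 1 := M.off_diagonal s t hst
  rw [geomReflection, geomReflection, Module.reflection_mul_reflection_pow (geomCoroot_self M s)
    (geomCoroot_self M t) (M s t) (2 * Real.cos (2 * (Real.pi / M s t)))
    (by rw [geomCoroot_single, geomCoroot_single, geomCoeff_mul_sub_two])]
  rcases Nat.lt_or_ge (M s t) 3 with h | h
  · obtain h0 | h2 : M s t = 0 ∨ M s t = 2 := by omega
    · rw [h0]
      have e1 : ((((0 : ℕ) : ℤ) - 1) / 2) = -1 := by norm_num
      have e2 : ((((0 : ℕ) : ℤ) - 2) / 2) = -1 := by norm_num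
      rw [e1, e2]
      simp
    · have hts : M t s = 2 := by rw [M.symmetric, h2]
      rw [h2]
      have e1 : ((((2 : ℕ) : ℤ) - 1) / 2) = 0 := by norm_num
      have e2 : ((((2 : ℕ) : ℤ) - 2) / 2) = 0 := by norm_num
      have e3 : ((((2 : ℕ) : ℤ) - 3) / 2) = -1 := by norm_num
      have e4 : ((((2 : ℕ) : ℤ)) / 2) = 1 := by norm_num
      rw [e1, e2, e3, e4]
      refine LinearMap.ext fun x => ?_
      have : 2 * (Real.pi / 2) = Real.pi := by ring
      simp [geomCoroot_single, geomCoeff_eq_zero M h2, geomCoeff_eq_zero M hts, this]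
      module
  · obtain ⟨k, hk | hk⟩ := Nat.even_or_odd' (M s t)
    · have h1 : (S ℝ (((M s t : ℤ) - 2) / 2)).eval (2 * Real.cos (2 * (Real.pi / M s t))) = 0 :=
        chebyshev_S_half_eq_zero h (by omega)
      have h2 : (S ℝ (((M s t : ℤ) - 1) / 2)).eval (2 * Real.cos (2 * (Real.pi / M s t))) = 0 :=
        chebyshev_S_half_eq_zero h (by omega)
      rw [h1, h2]
      simp
    · have h1 := chebyshev_S_add_eq_zero h (a := ((M s t : ℤ) - 1) / 2)
        (b := ((M s t : ℤ) - 3) / 2) (by omega)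
      have h2 := chebyshev_S_add_eq_zero h (a := (M s t : ℤ) / 2)
        (b := ((M s t : ℤ) - 2) / 2) (by omega)
      rw [h1, h2]
      simp

theorem geomReflection_mul_pow_ne_one (M : CoxeterMatrix B) {s t : B} (hst : s ≠ t) {k : ℕ}
    (hk : 0 < k) (hkm : M s t = 0 ∨ k < M s t) :
    (geomReflection M s * geomReflection M t) ^ k ≠ 1 := by
  intro h1
  have hm1 : M s t ≠ 1 := M.off_diagonal s t hst
  have h := Module.reflection_mul_reflection_pow_apply_self (geomCoroot_self M s)
    (geomCoroot_self M t) k (2 * Real.cos (2 * (Real.pi / M s t)))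
    (by rw [geomCoroot_single, geomCoroot_single, geomCoeff_mul_sub_two])
  have h1' : ((Module.reflection (geomCoroot_self M s) *
    Module.reflection (geomCoroot_self M t)) ^ k) = 1 := h1
  rw [h1', geomCoroot_single] at h
  have hs := DFunLike.congr_fun h s
  have ht := DFunLike.congr_fun h t
  simp [hst, hst.symm, geomCoroot_single] at hs ht
  rcases Nat.lt_or_ge (M s t) 3 with h3 | h3
  · obtain h0 | h2 : M s t = 0 ∨ M s t = 2 := by omega
    · have : M t s = 0 := by rw [M.symmetric, h0]
      rw [h0] at ht
      simp [geomCoeff, this] at ht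
      omega
    · have : k = 1 := by omega
      subst this
      have e : 2 * (Real.pi / 2) = Real.pi := by ring
      simp [h2, e] at hs
  · have hm3 : (3 : ℝ) ≤ M s t := by exact_mod_cast h3
    have hm0 : (M s t : ℝ) ≠ 0 := by positivity
    have hcos : geomCoeff M t s ≠ 0 := by
      rw [geomCoeff_comm, geomCoeff]
      have : 0 < Real.cos (Real.pi / M s t) := by
        apply Real.cos_pos_of_mem_Ioo
        constructor
        · have : 0 < Real.pi / M s t := by positivity
          linarith [Real.pi_pos]
        · rw [div_lt_div_iff₀ (by positivity) (by positivity)]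
          nlinarith [Real.pi_pos]
      nlinarith
    have hS : (S ℝ ((k : ℤ) - 1)).eval (2 * Real.cos (2 * (Real.pi / M s t))) = 0 := by
      rcases ht with ht | ht
      · exact ht
      · exact absurd ht hcos
    rw [hS, add_zero] at hs
    have hsin : Real.sin (2 * (Real.pi / M s t)) ≠ 0 := by
      refine (Real.sin_pos_of_pos_of_lt_pi (by positivity) ?_).ne'
      rw [← mul_div_assoc, div_lt_iff₀ (by positivity)]
      nlinarith [Real.pi_pos]
    have a1 := S_two_mul_real_cos (2 * (Real.pi / M s t)) ((k : ℤ) - 1)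
    have a2 := S_two_mul_real_cos (2 * (Real.pi / M s t)) k
    rw [hS, zero_mul] at a1
    rw [← hs, one_mul] at a2
    push_cast at a1 a2
    rw [sub_add_cancel] at a1
    rw [add_mul, one_mul, Real.sin_add, ← a1, zero_mul, zero_add] at a2
    have hc : Real.cos (k * (2 * (Real.pi / M s t))) = 1 :=
      mul_right_cancel₀ hsin (by rw [← a2, one_mul])
    obtain ⟨n, hn⟩ := (Real.cos_eq_one_iff _).1 hc
    have hpi := Real.pi_ne_zero
    have hkn : (n : ℝ) * M s t = k := by
      field_simp at hn
      linarith
    have hkn' : n * (M s t : ℤ) = k := by exact_mod_cast hkn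
    have hkm' : k < M s t := by omega
    have hn0 : 0 < n := by
      by_contra hn0
      have : n * (M s t : ℤ) ≤ 0 := mul_nonpos_of_nonpos_of_nonneg (by omega) (by omega)
      omega
    have : 1 * (M s t : ℤ) ≤ n * (M s t : ℤ) := mul_le_mul_of_nonneg_right (by omega) (by omega)
    omega

theorem simple_mul_pow_ne_one {W : Type*} [Group W] {M : CoxeterMatrix B} (cs : CoxeterSystem M W)
    {s t : B} (hst : s ≠ t) {k : ℕ} (hk : 0 < k) (hkm : M s t = 0 ∨ k < M s t) :
    (cs.simple s * cs.simple t) ^ k ≠ 1 := by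
  intro h
  have := congrArg (cs.lift ⟨geomReflection M, geomReflection_isLiftable M⟩) h
  rw [map_pow, map_mul, cs.lift_apply_simple, cs.lift_apply_simple, map_one] at this
  exact geomReflection_mul_pow_ne_one M hst hk hkm this

end GeometricRepresentation

/-! ### Alternating words -/

theorem length_altList (s t : B) (n : ℕ) : (altList s t n).length = n := by
  induction n generalizing s t with
  | zero => rfl
  | succ n ih => simp [altList, ih]

theorem altList_two_mul_append (s t : B) (n : ℕ) :
    altList s t (2 * n) ++ [s, t] = s :: t :: altList s t (2 * n) := by
  induction n with
  | zero => rfl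
  | succ n ih =>
    rw [Nat.mul_succ, altList, altList, cons_append, cons_append, ih]

theorem reverse_altList_two_mul (s t : B) (n : ℕ) :
    (altList s t (2 * n)).reverse = altList t s (2 * n) := by
  induction n with
  | zero => rfl
  | succ n ih =>
    rw [Nat.mul_succ, altList, altList, reverse_cons, reverse_cons, ih, append_assoc,
      altList, altList]
    exact altList_two_mul_append t s n

theorem prod_map_altList_two_mul {G : Type*} [Monoid G] (f : B → G) (s t : B) (n : ℕ) :
    ((altList s t (2 * n)).map f).prod = (f s * f t) ^ n := by
  induction n with
  | zero => simp [altList]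
  | succ n ih =>
    rw [Nat.mul_succ, altList, altList, map_cons, map_cons, prod_cons, prod_cons, ih, pow_succ',
      mul_assoc]

section Coxeter

variable {W : Type*} [Group W] {M : CoxeterMatrix B} (cs : CoxeterSystem M W)

/-! ### Inversion sequences and the exchange condition -/

theorem leftInvSeq_cons (s : B) (ω : List B) :
    cs.leftInvSeq (s :: ω) =
      cs.simple s :: (cs.leftInvSeq ω).map (fun r => cs.simple s * r * cs.simple s) := by
  simp [CoxeterSystem.leftInvSeq, MulAut.conj_apply]

theorem leftInvSeq_append (ω ω' : List B) :
    cs.leftInvSeq (ω ++ ω') = cs.leftInvSeq ω ++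
      (cs.leftInvSeq ω').map (fun r => cs.wordProd ω * r * (cs.wordProd ω)⁻¹) := by
  induction ω with
  | nil => simp
  | cons s ω ih =>
    rw [cons_append, leftInvSeq_cons, leftInvSeq_cons, ih, map_append, map_map, cons_append]
    simp [cs.wordProd_cons, Function.comp_def, mul_assoc]

theorem leftInvSeq_eq_map_rightInvSeq (ω : List B) :
    cs.leftInvSeq ω =
      (cs.rightInvSeq ω).map (fun r => cs.wordProd ω * r * (cs.wordProd ω)⁻¹) := by
  induction ω with
  | nil => simp
  | cons s ω ih =>
    rw [leftInvSeq_cons, ih, CoxeterSystem.rightInvSeq, map_cons, map_map]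
    simp [cs.wordProd_cons, Function.comp_def, mul_assoc]

theorem leftInvSeq_altList (s t : B) (n : ℕ) :
    cs.leftInvSeq (altList s t n) =
      (range n).map (fun k => (cs.simple s * cs.simple t) ^ k * cs.simple s) := by
  induction n generalizing s t with
  | zero => rfl
  | succ n ih =>
    rw [altList, leftInvSeq_cons, ih, range_succ_eq_map, map_cons, map_map, map_map]
    simp only [pow_zero, one_mul, Function.comp_def]
    congr 2
    funext k
    have h : (cs.simple t * cs.simple s) ^ k * cs.simple t =
        cs.simple t * (cs.simple s * cs.simple t) ^ k :=
      mul_pow_mul (cs.simple t) (cs.simple s) k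
    rw [h, pow_succ']
    simp only [mul_assoc]

section Parity

variable [DecidableEq W]

/-- The action of a simple reflection on pairs of an element and a sign, used to keep track of
inversions. -/
def signedPerm (s : B) : Equiv.Perm (W × ZMod 2) :=
  Function.Involutive.toPerm
    (fun p => (cs.simple s * p.1 * cs.simple s, p.2 + if p.1 = cs.simple s then 1 else 0)) (by
      rintro ⟨r, e⟩
      have : cs.simple s * r * cs.simple s = cs.simple s ↔ r = cs.simple s := by
        constructor
        · intro h
          have := congrArg (fun x => cs.simple s * x * cs.simple s) h
          simpa [mul_assoc] using this
        · rintro rfl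
          simp
      ext
      · simp [mul_assoc]
      · simp only [this]
        split_ifs
        · rw [add_assoc, show (1 : ZMod 2) + 1 = 0 from rfl, add_zero]
        · simp)

theorem signedPerm_apply (s : B) (p : W × ZMod 2) :
    signedPerm cs s p =
      (cs.simple s * p.1 * cs.simple s, p.2 + if p.1 = cs.simple s then 1 else 0) := rfl

theorem prod_map_signedPerm_apply (ω : List B) (p : W × ZMod 2) :
    (ω.map (signedPerm cs)).prod p = (cs.wordProd ω * p.1 * (cs.wordProd ω)⁻¹,
      p.2 + ((cs.rightInvSeq ω).count p.1 : ZMod 2)) := by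
  induction ω with
  | nil => simp
  | cons s ω ih =>
    rw [map_cons, prod_cons, Equiv.Perm.mul_apply, ih, signedPerm_apply,
      CoxeterSystem.rightInvSeq, count_cons]
    have : cs.wordProd ω * p.1 * (cs.wordProd ω)⁻¹ = cs.simple s ↔
        (cs.wordProd ω)⁻¹ * cs.simple s * cs.wordProd ω = p.1 := by
      constructor
      · intro h
        rw [← h]; group
      · intro h
        rw [← h]; group
    ext
    · simp [cs.wordProd_cons, mul_assoc]
    · simp only [this, beq_iff_eq, Nat.cast_add, Nat.cast_ite, Nat.cast_one, Nat.cast_zero,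
        add_assoc]

theorem signedPerm_isLiftable : M.IsLiftable (signedPerm cs) := by
  intro s t
  rw [← prod_map_altList_two_mul]
  ext1 p
  have hw : cs.wordProd (altList s t (2 * M s t)) = 1 := by
    rw [CoxeterSystem.wordProd, prod_map_altList_two_mul, cs.simple_mul_simple_pow]
  have hc : (cs.rightInvSeq (altList s t (2 * M s t))).count p.1 =
      2 * (cs.leftInvSeq (altList t s (M s t))).count p.1 := by
    have h : cs.rightInvSeq (altList s t (2 * M s t)) =
        (cs.leftInvSeq (altList t s (2 * M s t))).reverse := by
      rw [← cs.rightInvSeq_reverse, reverse_altList_two_mul]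
    rw [h, count_reverse, leftInvSeq_altList, leftInvSeq_altList, two_mul, range_add, map_append,
      count_append, map_map, two_mul]
    congr 2
    apply map_congr_left
    intro k _
    simp [pow_add]
  rw [prod_map_signedPerm_apply, hw, hc]
  ext
  · simp
  · have h2 : (2 : ZMod 2) = 0 := rfl
    simp [h2]

/-- The parity of the multiplicity of an element in the left inversion sequence of a word only
depends on the element of the Coxeter group represented by the word. -/
theorem count_leftInvSeq_eq {ω ω' : List B} (h : cs.wordProd ω = cs.wordProd ω') (r : W) :
    ((cs.leftInvSeq ω).count r : ZMod 2) = ((cs.leftInvSeq ω').count r : ZMod 2) := by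
  have key : ∀ ω : List B, (cs.lift ⟨signedPerm cs, signedPerm_isLiftable cs⟩
      (cs.wordProd ω)⁻¹ (r, 0)).2 = ((cs.leftInvSeq ω).count r : ZMod 2) := by
    intro ω
    rw [← cs.wordProd_reverse, CoxeterSystem.wordProd, map_list_prod, map_map]
    have : (⇑(cs.lift ⟨signedPerm cs, signedPerm_isLiftable cs⟩) ∘ cs.simple) = signedPerm cs := by
      funext s
      exact cs.lift_apply_simple _ s
    rw [this, prod_map_signedPerm_apply, cs.rightInvSeq_reverse, count_reverse, zero_add]
  rw [← key, ← key, h]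

theorem mem_leftInvSeq_of_odd_count {ω ω' : List B}
    (h : cs.wordProd ω = cs.wordProd ω') {r : W}
    (hr : ((cs.leftInvSeq ω).count r : ZMod 2) = 1) : r ∈ cs.leftInvSeq ω' := by
  by_contra hmem
  have := count_leftInvSeq_eq cs h r
  rw [count_eq_zero_of_not_mem (l := cs.leftInvSeq ω') hmem, Nat.cast_zero] at this
  have h10 : (1 : ZMod 2) ≠ 0 := one_ne_zero
  apply h10
  rw [← hr, this]

end Parity

theorem isReduced_of_nodup_leftInvSeq {ω : List B} (h : (cs.leftInvSeq ω).Nodup) :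
    cs.IsReduced ω := by
  classical
  obtain ⟨ω', hω', hp⟩ := cs.exists_isReduced (cs.wordProd ω)
  have hsub : cs.leftInvSeq ω ⊆ cs.leftInvSeq ω' := by
    intro r hr
    refine mem_leftInvSeq_of_odd_count cs hp ?_
    rw [count_eq_one_of_mem h hr, Nat.cast_one]
  have hlen := (h.subperm hsub).length_le
  rw [cs.length_leftInvSeq, cs.length_leftInvSeq, ← hω'.eq, ← hp] at hlen
  exact le_antisymm (cs.length_wordProd_le ω) hlen

theorem isReduced_altList {s t : B} (hst : s ≠ t) {k : ℕ} (hk : M s t = 0 ∨ k ≤ M s t) :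
    cs.IsReduced (altList s t k) := by
  apply isReduced_of_nodup_leftInvSeq
  rw [leftInvSeq_altList, nodup_map_iff_inj_on nodup_range]
  have key : ∀ i j, i < j → j < k → (cs.simple s * cs.simple t) ^ i * cs.simple s ≠
      (cs.simple s * cs.simple t) ^ j * cs.simple s := by
    intro i j hij hj h
    have h' := mul_right_cancel h
    obtain ⟨d, rfl⟩ := Nat.exists_eq_add_of_lt hij
    rw [add_assoc, pow_add, left_eq_mul] at h'
    refine simple_mul_pow_ne_one cs hst (k := d + 1) (by omega) ?_ h'
    omega
  intro i hi j hj h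
  rw [mem_range] at hi hj
  rcases lt_trichotomy i j with hij | hij | hij
  · exact absurd h (key i j hij hj)
  · exact hij
  · exact absurd h.symm (key j i hij hi)

theorem exists_eraseIdx_of_isLeftDescent {ω : List B} {s : B}
    (h : cs.IsLeftDescent (cs.wordProd ω) s) :
    ∃ j < ω.length, cs.simple s * cs.wordProd ω = cs.wordProd (ω.eraseIdx j) := by
  classical
  obtain ⟨ω', hω', hp⟩ := cs.exists_isReduced (cs.simple s * cs.wordProd ω)
  have hp' : cs.wordProd (s :: ω') = cs.wordProd ω := by
    rw [cs.wordProd_cons, ← hp, cs.simple_mul_simple_cancel_left]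
  have hred : cs.IsReduced (s :: ω') := by
    rw [cs.isLeftDescent_iff, hp, hω'.eq] at h
    rw [CoxeterSystem.IsReduced, hp', ← h, length_cons]
  have hmem : cs.simple s ∈ cs.leftInvSeq ω := by
    refine mem_leftInvSeq_of_odd_count cs hp' ?_
    rw [count_eq_one_of_mem hred.nodup_leftInvSeq (by rw [leftInvSeq_cons]; simp), Nat.cast_one]
  obtain ⟨j, hj, hjs⟩ := mem_iff_getElem.1 hmem
  refine ⟨j, by simpa using hj, ?_⟩
  rw [← cs.getD_leftInvSeq_mul_wordProd, getD_eq_getElem _ _ hj, hjs]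

/-! ### The weak order -/

/-- The weak order of a Coxeter group: `u` is a prefix of `w`. -/
def WeakLE (u w : W) : Prop := cs.length u + cs.length (u⁻¹ * w) = cs.length w

theorem exists_altList_prefix {w : W} {s t : B} (hst : s ≠ t) (hs : cs.IsLeftDescent w s)
    (ht : cs.IsLeftDescent w t) (k : ℕ) (hk : M s t = 0 ∨ k ≤ M s t) :
    (∃ ω : List B, w = cs.wordProd (altList s t k ++ ω) ∧ cs.length w = k + ω.length) ∧
      ∃ ω : List B, w = cs.wordProd (altList t s k ++ ω) ∧ cs.length w = k + ω.length := by
  have step : ∀ (k : ℕ) (a b : B), a ≠ b → (M a b = 0 ∨ k + 1 ≤ M a b) →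
      cs.IsLeftDescent w a →
      (∃ ω : List B, w = cs.wordProd (altList b a k ++ ω) ∧ cs.length w = k + ω.length) →
      ∃ ω : List B, w = cs.wordProd (altList a b (k + 1) ++ ω) ∧
        cs.length w = k + 1 + ω.length := by
    rintro k a b hab hk ha ⟨ω, hw, hl⟩
    rw [hw] at ha
    obtain ⟨j, hj, hje⟩ := exists_eraseIdx_of_isLeftDescent cs ha
    rw [length_append, length_altList] at hj
    rcases Nat.lt_or_ge j k with hjk | hjk
    · exfalso
      rw [eraseIdx_append_of_lt_length (by rwa [length_altList]), cs.wordProd_append,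
        cs.wordProd_append, ← mul_assoc] at hje
      have h1 := mul_right_cancel hje
      rw [← cs.wordProd_cons] at h1
      have h2 := (isReduced_altList cs hab hk).eq
      rw [altList, h1, length_cons, length_altList] at h2
      have h3 := cs.length_wordProd_le ((altList b a k).eraseIdx j)
      rw [length_eraseIdx_of_lt (by rwa [length_altList]), length_altList] at h3
      omega
    · rw [eraseIdx_append_of_length_le (by rwa [length_altList]), length_altList] at hje
      refine ⟨ω.eraseIdx (j - k), ?_, ?_⟩
      · rw [altList, cons_append, cs.wordProd_cons, ← hje, cs.simple_mul_simple_cancel_left, hw]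
      · rw [length_eraseIdx_of_lt (by omega)]
        omega
  induction k with
  | zero =>
    obtain ⟨ω, hω, hp⟩ := cs.exists_isReduced w
    have : cs.length w = 0 + ω.length := by rw [zero_add, hp, hω.eq]
    exact ⟨⟨ω, by simpa [altList] using hp, this⟩, ⟨ω, by simpa [altList] using hp, this⟩⟩
  | succ k ih =>
    obtain ⟨h1, h2⟩ := ih (by omega)
    exact ⟨step k s t hst hk hs h2, step k t s hst.symm (by rwa [M.symmetric]) ht h1⟩

theorem coxeterMatrix_ne_zero_of_isLeftDescent {w : W} {s t : B} (hst : s ≠ t)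
    (hs : cs.IsLeftDescent w s) (ht : cs.IsLeftDescent w t) : M s t ≠ 0 := by
  intro h
  obtain ⟨ω, -, hl⟩ := (exists_altList_prefix cs hst hs ht (cs.length w + 1) (Or.inl h)).1
  omega

theorem weakLE_altList {w : W} {s t : B} (hst : s ≠ t) (hs : cs.IsLeftDescent w s)
    (ht : cs.IsLeftDescent w t) : WeakLE cs (cs.wordProd (altList s t (M s t))) w := by
  obtain ⟨ω, hp, hl⟩ := (exists_altList_prefix cs hst hs ht (M s t) (Or.inr le_rfl)).1
  have h1 := (isReduced_altList cs hst (Or.inr le_rfl) : cs.IsReduced (altList s t (M s t))).eq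
  rw [length_altList] at h1
  have h2 := cs.length_wordProd_le ω
  have h3 := cs.length_mul_le (cs.wordProd (altList s t (M s t))) (cs.wordProd ω)
  rw [cs.wordProd_append] at hp
  rw [← hp] at h3
  rw [WeakLE, hp, inv_mul_cancel_left, ← hp]
  omega

theorem wordProd_altList_comm (s t : B) :
    cs.wordProd (altList s t (M s t)) = cs.wordProd (altList t s (M s t)) := by
  rw [altList_eq_reverse_alternatingWord, altList_eq_reverse_alternatingWord,
    cs.wordProd_reverse, cs.wordProd_reverse]
  have h := cs.wordProd_braidWord_eq t s
  rw [CoxeterSystem.braidWord, CoxeterSystem.braidWord, M.symmetric t s] at h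
  rw [h]

/-! ### The longest element -/

theorem odd_count_leftInvSeq_reflection [DecidableEq W] (ω : List B) (s : B) :
    ((cs.leftInvSeq (ω ++ s :: ω.reverse)).count
      (cs.wordProd ω * cs.simple s * (cs.wordProd ω)⁻¹) : ZMod 2) = 1 := by
  have hinj : ∀ x : W, Function.Injective (fun r => x * r * x⁻¹) := fun x a b h =>
    mul_left_cancel (mul_right_cancel h)
  have hinj' : Function.Injective (fun r => cs.simple s * r * cs.simple s) := fun a b h =>
    mul_left_cancel (mul_right_cancel h)
  rw [leftInvSeq_append, leftInvSeq_cons, count_append, map_cons, count_cons_self,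
    count_map_of_injective _ _ (hinj _), cs.leftInvSeq_reverse, map_reverse, count_reverse]
  have h1 : (cs.leftInvSeq ω).count (cs.wordProd ω * cs.simple s * (cs.wordProd ω)⁻¹) =
      (cs.rightInvSeq ω).count (cs.simple s) := by
    rw [leftInvSeq_eq_map_rightInvSeq]
    exact count_map_of_injective _ _ (hinj (cs.wordProd ω)) (cs.simple s)
  have h2 : ((cs.rightInvSeq ω).map (fun r => cs.simple s * r * cs.simple s)).count
      (cs.simple s) = (cs.rightInvSeq ω).count (cs.simple s) := by
    conv_lhs =>
      rw [show cs.simple s = (fun r => cs.simple s * r * cs.simple s) (cs.simple s) by simp]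
    simpa using count_map_of_injective _ _ hinj' (cs.simple s)
  rw [h1, h2]
  push_cast
  rw [← add_assoc, ← two_mul, show (2 : ZMod 2) = 0 from rfl, zero_mul, zero_add]

theorem length_mul_lt_of_odd_count [DecidableEq W] {ω : List B} {r : W}
    (hr : ((cs.leftInvSeq ω).count r : ZMod 2) = 1) :
    cs.length (r * cs.wordProd ω) < cs.length (cs.wordProd ω) := by
  obtain ⟨ω', hω', hp⟩ := cs.exists_isReduced (cs.wordProd ω)
  have := (cs.isLeftInversion_of_mem_leftInvSeq hω' (mem_leftInvSeq_of_odd_count cs hp hr)).2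
  rwa [← hp] at this

/-- A finite Coxeter group has a longest element. -/
theorem exists_longest [Finite W] :
    ∃ w₀ : W, ∀ x : W, cs.length (x * w₀) + cs.length x = cs.length w₀ := by
  classical
  obtain ⟨w₀, hmax⟩ := Finite.exists_max cs.length
  refine ⟨w₀, ?_⟩
  obtain ⟨ω₀, hω₀, rfl⟩ := cs.exists_isReduced w₀
  have hinj : ∀ x : W, Function.Injective (fun r => x * r * x⁻¹) := fun x a b h =>
    mul_left_cancel (mul_right_cancel h)
  have hrefl : ∀ (ω : List B) (s : B),
      cs.wordProd ω * cs.simple s * (cs.wordProd ω)⁻¹ ∈ cs.leftInvSeq ω₀ := by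
    intro ω s
    by_contra hr
    set r := cs.wordProd ω * cs.simple s * (cs.wordProd ω)⁻¹ with hrdef
    have hprod : cs.wordProd (ω ++ s :: ω.reverse) = r := by
      rw [cs.wordProd_append, cs.wordProd_cons, cs.wordProd_reverse, hrdef, mul_assoc]
    have hrr : r * r = 1 := by
      rw [hrdef]; simp [mul_assoc]
    have hcount : ((cs.leftInvSeq ((ω ++ s :: ω.reverse) ++ ω₀)).count r : ZMod 2) = 1 := by
      rw [leftInvSeq_append, count_append, Nat.cast_add, hrdef, odd_count_leftInvSeq_reflection,
        ← hrdef, hprod, count_eq_zero_of_not_mem]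
      · simp
      · intro hmem
        obtain ⟨y, hy, hyr⟩ := mem_map.1 hmem
        have : y = r := by
          have hyr' : r * y * r⁻¹ = r * r * r⁻¹ := by rw [hyr, mul_inv_cancel_right]
          exact hinj r hyr'
        exact hr (this ▸ hy)
    have hlt := length_mul_lt_of_odd_count cs hcount
    rw [cs.wordProd_append, hprod, ← mul_assoc, hrr, one_mul] at hlt
    exact absurd (hmax (r * cs.wordProd ω₀)) (not_le.2 hlt)
  intro x
  obtain ⟨ω, hω, rfl⟩ := cs.exists_isReduced x
  rw [hω.eq]
  induction ω with
  | nil => simp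
  | cons s ω ih =>
    have hω' : cs.IsReduced ω := hω.drop 1
    have hd : cs.length (cs.simple s * (cs.wordProd ω * cs.wordProd ω₀)) <
        cs.length (cs.wordProd ω * cs.wordProd ω₀) := by
      have hcount : ((cs.leftInvSeq (ω ++ ω₀)).count (cs.simple s) : ZMod 2) = 1 := by
        have h1 : cs.simple s ∉ cs.leftInvSeq ω := by
          intro hmem
          have hn := hω.nodup_leftInvSeq
          rw [leftInvSeq_cons, nodup_cons] at hn
          exact hn.1 (mem_map.2 ⟨_, hmem, by simp⟩)
        have h2 := hrefl ω.reverse s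
        rw [cs.wordProd_reverse, inv_inv] at h2
        have h3 : cs.simple s = (fun r => cs.wordProd ω * r * (cs.wordProd ω)⁻¹)
            ((cs.wordProd ω)⁻¹ * cs.simple s * cs.wordProd ω) := by
          simp [mul_assoc]
        rw [leftInvSeq_append, count_append, count_eq_zero_of_not_mem h1, h3,
          count_map_of_injective _ _ (hinj _), count_eq_one_of_mem hω₀.nodup_leftInvSeq h2]
        simp
      have := length_mul_lt_of_odd_count cs hcount
      rwa [cs.wordProd_append] at this
    have := ih hω'
    rcases cs.length_simple_mul (cs.wordProd ω * cs.wordProd ω₀) s with h | h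
    · omega
    · rw [cs.wordProd_cons, length_cons, mul_assoc]
      omega

end Coxeter

/-! ### Greatest elements from local joins -/

/-- A subset with a least element and of bounded rank, in which any two elements above `y` are
preceded by elements strictly above `y` having a common upper bound, has a greatest element. -/
theorem exists_greatest_of_local_join {T : Type*} (r : T → T → Prop) (hrefl : ∀ x, r x x)
    (htrans : ∀ x y z, r x y → r y z → r x z) (rank : T → ℕ) (E : Set T) (N : ℕ)
    (hN : ∀ x ∈ E, rank x ≤ N) (o : T) (ho : o ∈ E) (hbot : ∀ x ∈ E, r o x)
    (hrank : ∀ x y, r x y → x = y ∨ rank x < rank y)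
    (hloc : ∀ y ∈ E, ∀ z₁ ∈ E, ∀ z₂ ∈ E, r y z₁ → r y z₂ → y ≠ z₁ → y ≠ z₂ →
      ∃ a ∈ E, ∃ b ∈ E, ∃ c ∈ E, r y a ∧ y ≠ a ∧ r y b ∧ y ≠ b ∧ r a z₁ ∧ r b z₂ ∧
        r a c ∧ r b c) :
    ∃ g ∈ E, ∀ x ∈ E, r x g := by
  have hdir : ∀ n, ∀ y ∈ E, N - rank y ≤ n → ∀ z₁ ∈ E, ∀ z₂ ∈ E, r y z₁ → r y z₂ →
      ∃ c ∈ E, r z₁ c ∧ r z₂ c := by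
    intro n
    induction n with
    | zero =>
      intro y hy hn z₁ h₁ z₂ h₂ hy₁ hy₂
      have : y = z₁ := (hrank _ _ hy₁).resolve_right (by have := hN z₁ h₁; omega)
      exact ⟨z₂, h₂, this ▸ hy₂, hrefl _⟩
    | succ n ih =>
      intro y hy hn z₁ h₁ z₂ h₂ hy₁ hy₂
      rcases eq_or_ne y z₁ with rfl | hne₁
      · exact ⟨z₂, h₂, hy₂, hrefl _⟩
      rcases eq_or_ne y z₂ with rfl | hne₂
      · exact ⟨z₁, h₁, hrefl _, hy₁⟩
      obtain ⟨a, ha, b, hb, c, hc, hya, hna, hyb, hnb, haz, hbz, hac, hbc⟩ :=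
        hloc y hy z₁ h₁ z₂ h₂ hy₁ hy₂ hne₁ hne₂
      have hra := (hrank _ _ hya).resolve_left hna
      have hrb := (hrank _ _ hyb).resolve_left hnb
      obtain ⟨d, hd, h₁d, hcd⟩ := ih a ha (by omega) z₁ h₁ c hc haz hac
      obtain ⟨e, he, h₂e, hde⟩ := ih b hb (by omega) z₂ h₂ d hd hbz (htrans _ _ _ hbc hcd)
      exact ⟨e, he, htrans _ _ _ h₁d hde, h₂e⟩
  have hbdd : BddAbove (rank '' E) := ⟨N, by rintro _ ⟨x, hx, rfl⟩; exact hN x hx⟩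
  obtain ⟨g, hg, hgmax⟩ := Nat.sSup_mem (Set.Nonempty.image rank ⟨o, ho⟩) hbdd
  refine ⟨g, hg, fun x hx => ?_⟩
  obtain ⟨c, hc, hgc, hxc⟩ := hdir _ o ho le_rfl g hg x hx (hbot g hg) (hbot x hx)
  have hle : rank c ≤ rank g := hgmax ▸ le_csSup hbdd ⟨c, hc, rfl⟩
  rcases hrank _ _ hgc with rfl | h
  · exact hxc
  · omega

section Coxeter

variable {W : Type*} [Group W] {M : CoxeterMatrix B} (cs : CoxeterSystem M W)

/-! ### Meets in the weak order -/

theorem weakLE_mul_iff {u z : W} :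
    WeakLE cs u (u * z) ↔ cs.length u + cs.length z = cs.length (u * z) := by
  rw [WeakLE, inv_mul_cancel_left]

variable {cs}

theorem WeakLE.refl (u : W) : WeakLE cs u u := by
  simp [WeakLE]

theorem WeakLE.one_le (u : W) : WeakLE cs 1 u := by
  simp [WeakLE]

theorem WeakLE.trans {u v w : W} (h : WeakLE cs u v) (h' : WeakLE cs v w) : WeakLE cs u w := by
  unfold WeakLE at *
  have h₁ := cs.length_mul_le (u⁻¹ * v) (v⁻¹ * w)
  have h₂ := cs.length_mul_le u (u⁻¹ * w)
  rw [mul_assoc, mul_inv_cancel_left] at h₁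
  rw [mul_inv_cancel_left] at h₂
  omega

theorem WeakLE.eq_or_length_lt {u v : W} (h : WeakLE cs u v) :
    u = v ∨ cs.length u < cs.length v := by
  rcases Nat.eq_zero_or_pos (cs.length (u⁻¹ * v)) with h0 | h0
  · left
    rwa [cs.length_eq_zero_iff, inv_mul_eq_one] at h0
  · right
    unfold WeakLE at h
    omega

theorem WeakLE.antisymm {u v : W} (h : WeakLE cs u v) (h' : WeakLE cs v u) : u = v := by
  rcases h.eq_or_length_lt with h₁ | h₁
  · exact h₁
  · rcases h'.eq_or_length_lt with h₂ | h₂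
    · exact h₂.symm
    · omega

theorem WeakLE.mul_left_iff {v z z' : W} (h : WeakLE cs v (v * z)) (h' : WeakLE cs v (v * z')) :
    WeakLE cs (v * z) (v * z') ↔ WeakLE cs z z' := by
  rw [weakLE_mul_iff] at h h'
  unfold WeakLE
  rw [mul_inv_rev, mul_assoc, inv_mul_cancel_left]
  omega

theorem WeakLE.inv_mul {u v w : W} (h : WeakLE cs u v) (h' : WeakLE cs v w) :
    WeakLE cs (u⁻¹ * v) (u⁻¹ * w) := by
  have h'' := h.trans h'
  rw [← WeakLE.mul_left_iff (v := u)]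
  · simpa using h'
  · simpa using h
  · simpa using h''

theorem isLeftDescent_iff_weakLE {w : W} {s : B} :
    cs.IsLeftDescent w s ↔ WeakLE cs (cs.simple s) w := by
  rw [cs.isLeftDescent_iff, WeakLE, cs.length_simple, cs.inv_simple, add_comm]

theorem WeakLE.exists_simple {u w : W} (h : WeakLE cs u w) (hne : u ≠ w) :
    ∃ s, WeakLE cs u (u * cs.simple s) ∧ WeakLE cs (u * cs.simple s) w := by
  obtain ⟨s, hs⟩ := cs.exists_leftDescent_of_ne_one (w := u⁻¹ * w) (by rwa [Ne, inv_mul_eq_one])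
  rw [isLeftDescent_iff_weakLE] at hs
  refine ⟨s, ?_⟩
  have h₁ : WeakLE cs u (u * cs.simple s) := by
    rw [weakLE_mul_iff]
    unfold WeakLE at h hs
    have h₁ := cs.length_mul_le u (cs.simple s)
    have h₂ := cs.length_mul_le (u * cs.simple s) ((cs.simple s)⁻¹ * (u⁻¹ * w))
    rw [mul_assoc, mul_inv_cancel_left, mul_inv_cancel_left] at h₂
    omega
  refine ⟨h₁, ?_⟩
  have := (WeakLE.mul_left_iff h₁ (z' := u⁻¹ * w) (by simpa using h)).2 hs
  simpa using this

theorem WeakLE.mul_altList {u w : W} {s t : B} (hst : s ≠ t)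
    (hs : WeakLE cs u (u * cs.simple s)) (hs' : WeakLE cs (u * cs.simple s) w)
    (ht : WeakLE cs u (u * cs.simple t)) (ht' : WeakLE cs (u * cs.simple t) w) :
    WeakLE cs (u * cs.simple s) (u * cs.wordProd (altList s t (M s t))) ∧
      WeakLE cs (u * cs.wordProd (altList s t (M s t))) w := by
  have hw := hs.trans hs'
  have hs₁ := isLeftDescent_iff_weakLE.2 (by simpa using hs.inv_mul hs')
  have ht₁ := isLeftDescent_iff_weakLE.2 (by simpa using ht.inv_mul ht')
  have hle := weakLE_altList cs hst hs₁ ht₁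
  have hm := coxeterMatrix_ne_zero_of_isLeftDescent cs hst hs₁ ht₁
  have huD : WeakLE cs u (u * cs.wordProd (altList s t (M s t))) := by
    rw [weakLE_mul_iff]
    unfold WeakLE at hle hw
    have h₁ := cs.length_mul_le u (cs.wordProd (altList s t (M s t)))
    have h₂ := cs.length_mul_le (u * cs.wordProd (altList s t (M s t)))
      ((cs.wordProd (altList s t (M s t)))⁻¹ * (u⁻¹ * w))
    rw [mul_assoc, mul_inv_cancel_left, mul_inv_cancel_left] at h₂
    omega
  constructor
  · rw [WeakLE.mul_left_iff hs huD]
    have hred := (isReduced_altList cs hst (Or.inr le_rfl) :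
      cs.IsReduced (altList s t (M s t))).eq
    obtain ⟨m, hm⟩ := Nat.exists_eq_succ_of_ne_zero hm
    rw [hm, Nat.succ_eq_add_one, altList, cs.wordProd_cons, length_cons, length_altList] at hred
    rw [hm, Nat.succ_eq_add_one, altList, cs.wordProd_cons, weakLE_mul_iff, hred,
      cs.length_simple]
    have h₁ := cs.length_wordProd_le (altList t s m)
    have h₂ := cs.length_mul_le (cs.simple s) (cs.wordProd (altList t s m))
    rw [length_altList] at h₁
    rw [hred, cs.length_simple] at h₂
    omega
  · have := (WeakLE.mul_left_iff huD (z' := u⁻¹ * w) (by simpa using hw)).2 hle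
    simpa using this

theorem WeakLE.exists_meet (w w' : W) :
    ∃ m, (WeakLE cs m w ∧ WeakLE cs m w') ∧
      ∀ z, WeakLE cs z w → WeakLE cs z w' → WeakLE cs z m := by
  obtain ⟨m, hm, hmax⟩ := exists_greatest_of_local_join (WeakLE cs) WeakLE.refl
    (fun _ _ _ => WeakLE.trans) cs.length {z | WeakLE cs z w ∧ WeakLE cs z w'} (cs.length w)
    (fun x hx => by have := hx.1; unfold WeakLE at this; omega) 1
    ⟨WeakLE.one_le _, WeakLE.one_le _⟩ (fun _ _ => WeakLE.one_le _)
    (fun _ _ => WeakLE.eq_or_length_lt) (by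
      intro y hy z₁ h₁ z₂ h₂ hy₁ hy₂ hne₁ hne₂
      obtain ⟨s, hs, hs'⟩ := hy₁.exists_simple hne₁
      obtain ⟨t, ht, ht'⟩ := hy₂.exists_simple hne₂
      have hne : ∀ s, y ≠ y * cs.simple s := fun s h => by
        have := congrArg cs.length (left_eq_mul.1 h)
        simp at this
      refine ⟨y * cs.simple s, ⟨hs'.trans h₁.1, hs'.trans h₁.2⟩, y * cs.simple t,
        ⟨ht'.trans h₂.1, ht'.trans h₂.2⟩, ?_⟩
      rcases eq_or_ne s t with rfl | hst
      · exact ⟨y * cs.simple s, ⟨hs'.trans h₁.1, hs'.trans h₁.2⟩, hs, hne s, ht, hne s, hs', ht',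
          WeakLE.refl _, WeakLE.refl _⟩
      · have k := fun {w} (h₁ : WeakLE cs z₁ w) (h₂ : WeakLE cs z₂ w) =>
          WeakLE.mul_altList hst hs (hs'.trans h₁) ht (ht'.trans h₂)
        have k' := fun {w} (h₁ : WeakLE cs z₁ w) (h₂ : WeakLE cs z₂ w) =>
          WeakLE.mul_altList hst.symm ht (ht'.trans h₂) hs (hs'.trans h₁)
        refine ⟨y * cs.wordProd (altList s t (M s t)), ⟨(k h₁.1 h₂.1).2, (k h₁.2 h₂.2).2⟩, hs,
          hne s, ht, hne t, hs', ht', (k h₁.1 h₂.1).1, ?_⟩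
        rw [wordProd_altList_comm, M.symmetric]
        exact (k' h₁.1 h₂.1).1)
  exact ⟨m, hm, fun z h h' => hmax z ⟨h, h'⟩⟩

variable (cs)

theorem exists_greatest_reduced_prefix [Finite W] (u w : W) :
    ∃ m, (WeakLE cs m w ∧ WeakLE cs u (u * m)) ∧
      ∀ z, WeakLE cs z w → WeakLE cs u (u * z) → WeakLE cs z m := by
  obtain ⟨w₀, hw₀⟩ := exists_longest cs
  have key : ∀ z, WeakLE cs u (u * z) ↔ WeakLE cs z (u⁻¹ * w₀) := by
    intro z
    have h₁ := hw₀ u⁻¹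
    have h₂ := hw₀ (u * z)⁻¹
    rw [cs.length_inv] at h₁ h₂
    rw [weakLE_mul_iff, WeakLE, ← mul_assoc, ← mul_inv_rev]
    omega
  simp only [key]
  exact WeakLE.exists_meet _ _

/-- The greatest prefix `m` of `w` such that the product `u * m` is reduced. -/
noncomputable def absorb [Finite W] (u w : W) : W :=
  (exists_greatest_reduced_prefix cs u w).choose

variable [Finite W]

theorem absorb_weakLE (u w : W) : WeakLE cs (absorb cs u w) w :=
  (exists_greatest_reduced_prefix cs u w).choose_spec.1.1

theorem weakLE_mul_absorb (u w : W) : WeakLE cs u (u * absorb cs u w) :=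
  (exists_greatest_reduced_prefix cs u w).choose_spec.1.2

theorem weakLE_absorb {u w z : W} (h : WeakLE cs z w) (h' : WeakLE cs u (u * z)) :
    WeakLE cs z (absorb cs u w) :=
  (exists_greatest_reduced_prefix cs u w).choose_spec.2 z h h'

theorem absorb_eq_of_weakLE {u w : W} (h : WeakLE cs u (u * w)) : absorb cs u w = w :=
  (absorb_weakLE cs u w).antisymm (weakLE_absorb cs (WeakLE.refl w) h)

theorem absorb_mul {u v : W} (huv : WeakLE cs u (u * v)) (w : W) :
    absorb cs u (v * absorb cs v w) = v * absorb cs (u * v) w := by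
  set a := absorb cs v w with ha
  set b := absorb cs u (v * a) with hb
  set c := absorb cs (u * v) w with hc
  have hva : WeakLE cs v (v * a) := weakLE_mul_absorb cs v w
  have huvc : WeakLE cs (u * v) (u * v * c) := weakLE_mul_absorb cs (u * v) w
  have hub : WeakLE cs u (u * b) := weakLE_mul_absorb cs u (v * a)
  have hbva : WeakLE cs b (v * a) := absorb_weakLE cs u (v * a)
  have h₁ := cs.length_mul_le u (v * c)
  have h₂ := cs.length_mul_le v c
  rw [← mul_assoc] at h₁
  have huvc' := huvc
  have huv' := huv
  rw [weakLE_mul_iff] at huvc' huv'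
  have hvc : WeakLE cs v (v * c) := by
    rw [weakLE_mul_iff]
    omega
  have hvb : WeakLE cs v b := weakLE_absorb cs hva huv
  apply WeakLE.antisymm (cs := cs)
  · have hz : WeakLE cs (v⁻¹ * b) a := by simpa using hvb.inv_mul hbva
    have hred : WeakLE cs (u * v) (u * v * (v⁻¹ * b)) := by
      rw [weakLE_mul_iff, mul_assoc, mul_inv_cancel_left]
      rw [weakLE_mul_iff] at hub
      unfold WeakLE at hvb
      omega
    have hzc : WeakLE cs (v⁻¹ * b) c :=
      weakLE_absorb cs (hz.trans (absorb_weakLE cs v w)) hred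
    have := (WeakLE.mul_left_iff (z := v⁻¹ * b) (by simpa using hvb) hvc).2 hzc
    simpa using this
  · refine weakLE_absorb cs ?_ ?_
    · rw [WeakLE.mul_left_iff hvc hva]
      exact weakLE_absorb cs (absorb_weakLE cs (u * v) w) hvc
    · rw [weakLE_mul_iff, ← mul_assoc]
      omega

end Coxeter

/-! ### The abstract positive monoid -/

/-- The braid relations of `M` on the free monoid. -/
def braidRel (M : CoxeterMatrix B) (a b : FreeMonoid B) : Prop :=
  ∃ s t : B, s ≠ t ∧ M s t ≠ 0 ∧ a = FreeMonoid.ofList (altList s t (M s t)) ∧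
    b = FreeMonoid.ofList (altList t s (M s t))

/-- The monoid presented by the braid relations of `M`. -/
abbrev PosArtin (M : CoxeterMatrix B) : Type _ := PresentedMonoid (braidRel M)

namespace PosArtin

variable (M : CoxeterMatrix B)

/-- The generators of `PosArtin M`. -/
def atom (s : B) : PosArtin M := PresentedMonoid.of (braidRel M) s

/-- The element of `PosArtin M` represented by a word. -/
def word (ω : List B) : PosArtin M := (ω.map (atom M)).prod

@[simp]
theorem word_nil : word M [] = 1 := rfl

theorem word_cons (s : B) (ω : List B) : word M (s :: ω) = atom M s * word M ω := by
  simp [word]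

theorem word_append (ω ω' : List B) : word M (ω ++ ω') = word M ω * word M ω' := by
  simp [word]

theorem word_singleton (s : B) : word M [s] = atom M s := by
  simp [word]

theorem exists_word (p : PosArtin M) : ∃ ω, p = word M ω := by
  induction p using PresentedMonoid.inductionOn with
  | h a =>
    refine ⟨a.toList, ?_⟩
    induction a with
    | one => rfl
    | of x => rfl
    | mul x y hx hy => rw [map_mul, hx, hy, ← word_append]; rfl

theorem word_altList_comm (s t : B) :
    word M (altList s t (M s t)) = word M (altList t s (M s t)) := by
  rcases eq_or_ne s t with rfl | hst
  · rfl
  rcases eq_or_ne (M s t) 0 with h0 | h0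
  · rw [h0]; rfl
  have h := PresentedMonoid.mk_eq_mk_of_rel (rels := braidRel M) ⟨s, t, hst, h0, rfl, rfl⟩
  have key : ∀ ω : List B, PresentedMonoid.mk (braidRel M) (FreeMonoid.ofList ω) = word M ω := by
    intro ω
    induction ω with
    | nil => rfl
    | cons a ω ih => rw [FreeMonoid.ofList_cons, map_mul, ih, word_cons]; rfl
  rwa [key, key] at h

variable {M}

/-- The universal property of `PosArtin M`. -/
def lift {N : Type*} [Monoid N] (f : B → N)
    (hf : ∀ s t, s ≠ t → M s t ≠ 0 →
      ((altList s t (M s t)).map f).prod = ((altList t s (M s t)).map f).prod) :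
    PosArtin M →* N :=
  PresentedMonoid.lift f (by
    rintro _ _ ⟨s, t, hst, h0, rfl, rfl⟩
    rw [FreeMonoid.lift_ofList, FreeMonoid.lift_ofList]
    exact hf s t hst h0)

section lift

variable {N : Type*} [Monoid N] (f : B → N)
    (hf : ∀ s t, s ≠ t → M s t ≠ 0 →
      ((altList s t (M s t)).map f).prod = ((altList t s (M s t)).map f).prod)

@[simp]
theorem lift_atom (s : B) : lift f hf (atom M s) = f s := rfl

theorem lift_word (ω : List B) : lift f hf (word M ω) = (ω.map f).prod := by
  rw [word, map_list_prod, map_map]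
  rfl

end lift

/-! ### Reduced words -/

section Coxeter

variable {W : Type*} [Group W] (cs : CoxeterSystem M W)

/-- Matsumoto's theorem: reduced words with the same product are related by braid relations. -/
theorem word_eq_of_isReduced {ω ω' : List B} (hω : cs.IsReduced ω) (hω' : cs.IsReduced ω')
    (h : cs.wordProd ω = cs.wordProd ω') : word M ω = word M ω' := by
  have hlen : ω.length = ω'.length := by rw [← hω.eq, ← hω'.eq, h]
  induction hn : ω.length using Nat.strong_induction_on generalizing ω ω' with
  | _ n ih =>
    subst hn
    match ω, ω', hlen with
    | [], [], _ => rfl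
    | s :: a, t :: b, hlen =>
      have ha : cs.IsReduced a := hω.drop 1
      have hb : cs.IsReduced b := hω'.drop 1
      rw [length_cons, length_cons, add_left_inj] at hlen
      rcases eq_or_ne s t with rfl | hst
      · rw [cs.wordProd_cons, cs.wordProd_cons, mul_right_inj] at h
        rw [word_cons, word_cons, ih _ (by simp) ha hb h hlen rfl]
      · have hs : cs.IsLeftDescent (cs.wordProd (s :: a)) s := by
          rw [cs.isLeftDescent_iff, hω.eq, cs.wordProd_cons, cs.simple_mul_simple_cancel_left,
            ha.eq, length_cons]
        have ht : cs.IsLeftDescent (cs.wordProd (s :: a)) t := by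
          rw [h, cs.isLeftDescent_iff, hω'.eq, cs.wordProd_cons, cs.simple_mul_simple_cancel_left,
            hb.eq, length_cons]
        obtain ⟨m, hm⟩ := Nat.exists_eq_succ_of_ne_zero
          (coxeterMatrix_ne_zero_of_isLeftDescent cs hst hs ht)
        obtain ⟨υ, hυ, hl⟩ := (exists_altList_prefix cs hst hs ht (M s t) (Or.inr le_rfl)).1
        have hυ' : cs.wordProd (t :: b) = cs.wordProd (altList t s (M s t) ++ υ) := by
          rw [← h, hυ, cs.wordProd_append, cs.wordProd_append, wordProd_altList_comm,
            M.symmetric s t]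
        have hwl : (s :: a).length = m + 1 + υ.length := by rw [← hω.eq, hl, hm]
        have hred : cs.IsReduced (altList s t (M s t) ++ υ) := by
          rw [CoxeterSystem.IsReduced, ← hυ, hl, length_append, length_altList]
        have hred' : cs.IsReduced (altList t s (M s t) ++ υ) := by
          rw [CoxeterSystem.IsReduced, ← hυ', ← h, hl, length_append, length_altList]
        have hbraid : word M (altList s t (M s t) ++ υ) = word M (altList t s (M s t) ++ υ) := by
          rw [word_append, word_append, word_altList_comm]
        rw [hm, Nat.succ_eq_add_one] at hυ hυ' hred hred' hbraid
        rw [length_cons] at hwl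
        rw [altList, cons_append, cs.wordProd_cons, cs.wordProd_cons, mul_right_inj] at hυ hυ'
        rw [altList, altList, cons_append, cons_append] at hbraid
        rw [altList, cons_append] at hred hred'
        rw [word_cons, ih _ (by simp) ha (hred.drop 1) hυ
            (by simp [length_altList]; omega) rfl, ← word_cons, drop_one, tail_cons, hbraid,
          word_cons, word_cons,
          ih _ (by simp [hlen]) hb (hred'.drop 1) hυ' (by simp [length_altList]; omega) rfl]
        rfl

/-- The canonical section of the projection from `PosArtin M` to the Coxeter group. -/
noncomputable def canon (w : W) : PosArtin M :=
  word M (cs.exists_isReduced w).choose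

theorem canon_wordProd {ω : List B} (hω : cs.IsReduced ω) :
    canon cs (cs.wordProd ω) = word M ω := by
  obtain ⟨h, h'⟩ := (cs.exists_isReduced (cs.wordProd ω)).choose_spec
  exact word_eq_of_isReduced cs h hω h'.symm

theorem canon_mul {u v : W} (h : WeakLE cs u (u * v)) :
    canon cs (u * v) = canon cs u * canon cs v := by
  obtain ⟨ω, hω, rfl⟩ := cs.exists_isReduced u
  obtain ⟨ω', hω', rfl⟩ := cs.exists_isReduced v
  rw [weakLE_mul_iff, hω.eq, hω'.eq, ← cs.wordProd_append] at h
  rw [← cs.wordProd_append, canon_wordProd cs (by rw [CoxeterSystem.IsReduced, ← h, length_append]),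
    canon_wordProd cs hω, canon_wordProd cs hω', word_append]

theorem canon_mul_canon_inv_mul {u w : W} (h : WeakLE cs u w) :
    canon cs u * canon cs (u⁻¹ * w) = canon cs w := by
  rw [← canon_mul cs (by simpa using h), mul_inv_cancel_left]

theorem canon_one : canon cs 1 = 1 := by
  simpa using canon_wordProd cs (ω := []) (by simp [CoxeterSystem.IsReduced])

theorem canon_simple (s : B) : canon cs (cs.simple s) = atom M s := by
  rw [← cs.wordProd_singleton, canon_wordProd cs (by simp [CoxeterSystem.IsReduced]),
    word_singleton]

/-! ### The greedy normal form -/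

theorem _root_.ArtinTitsPaper.WeakLE.of_mul_mul {cs : CoxeterSystem M W} {u v c : W}
    (h : WeakLE cs u (u * v)) (h' : WeakLE cs (u * v) (u * v * c)) : WeakLE cs v (v * c) := by
  rw [weakLE_mul_iff] at *
  have h₁ := cs.length_mul_le u (v * c)
  have h₂ := cs.length_mul_le v c
  rw [← mul_assoc] at h₁
  omega

variable [Finite W]

/-- Left multiplication by (the lift of) an element of the Coxeter group, on normal forms. -/
noncomputable def push (u : W) : Function.End (W × PosArtin M) := fun x =>
  (u * absorb cs u x.1, canon cs ((absorb cs u x.1)⁻¹ * x.1) * x.2)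

theorem push_apply (u : W) (x : W × PosArtin M) :
    push cs u x = (u * absorb cs u x.1, canon cs ((absorb cs u x.1)⁻¹ * x.1) * x.2) := rfl

theorem push_one : push cs 1 = 1 := by
  funext x
  rw [push_apply, absorb_eq_of_weakLE cs (WeakLE.one_le _), one_mul, inv_mul_cancel, canon_one,
    one_mul]
  rfl

theorem push_mul {u v : W} (h : WeakLE cs u (u * v)) : push cs u * push cs v = push cs (u * v) := by
  funext ⟨w, p⟩
  change push cs u (push cs v (w, p)) = _
  simp only [push_apply]
  rw [absorb_mul cs h w, ← mul_assoc, ← mul_assoc, mul_inv_rev, mul_assoc _ v⁻¹,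
    inv_mul_cancel_left]
  congr 2
  have hvc : WeakLE cs v (v * absorb cs (u * v) w) := h.of_mul_mul (weakLE_mul_absorb cs _ _)
  have hca : WeakLE cs (absorb cs (u * v) w) (absorb cs v w) :=
    weakLE_absorb cs (absorb_weakLE cs _ _) hvc
  have := canon_mul_canon_inv_mul cs (hca.inv_mul (absorb_weakLE cs v w))
  rwa [mul_inv_rev, inv_inv, mul_assoc, mul_inv_cancel_left] at this

theorem prod_map_push {ω : List B} (hω : cs.IsReduced ω) :
    (ω.map (fun s => push cs (cs.simple s))).prod = push cs (cs.wordProd ω) := by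
  induction ω with
  | nil => simp [push_one]
  | cons s ω ih =>
    have h : cs.IsReduced ω := hω.drop 1
    rw [map_cons, prod_cons, ih h, cs.wordProd_cons, push_mul]
    rw [weakLE_mul_iff, ← cs.wordProd_cons, hω.eq, h.eq, cs.length_simple, length_cons, add_comm]

/-- The action of `PosArtin M` on normal forms. -/
noncomputable def pushHom : PosArtin M →* Function.End (W × PosArtin M) :=
  lift (fun s => push cs (cs.simple s)) (by
    intro s t hst _
    rw [prod_map_push cs (isReduced_altList cs hst (Or.inr le_rfl)),
      prod_map_push cs (isReduced_altList cs hst.symm (Or.inr (M.symmetric s t).le)),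
      wordProd_altList_comm, M.symmetric])

/-- The normal form of an element: its greatest reduced left divisor and the quotient. -/
noncomputable def normalForm (g : PosArtin M) : W × PosArtin M := pushHom cs g (1, 1)

theorem normalForm_atom_mul (s : B) (g : PosArtin M) :
    normalForm cs (atom M s * g) = push cs (cs.simple s) (normalForm cs g) := by
  rw [normalForm, map_mul]
  rfl

theorem canon_mul_normalForm (g : PosArtin M) :
    canon cs (normalForm cs g).1 * (normalForm cs g).2 = g := by
  obtain ⟨ω, rfl⟩ := exists_word M g
  induction ω with
  | nil =>
    rw [word_nil, normalForm, map_one, Function.End.one_def]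
    simp [canon_one]
  | cons s ω ih =>
    rw [word_cons, normalForm_atom_mul, push_apply]
    rw [canon_mul cs (weakLE_mul_absorb cs _ _), canon_simple, mul_assoc,
      ← mul_assoc (canon cs (absorb cs _ _)), canon_mul_canon_inv_mul cs (absorb_weakLE cs _ _), ih]

theorem isLeftDescent_normalForm {s : B} {g : PosArtin M} (h : atom M s ∣ g) :
    cs.IsLeftDescent (normalForm cs g).1 s := by
  obtain ⟨g, rfl⟩ := h
  rw [normalForm_atom_mul, push_apply, isLeftDescent_iff_weakLE]
  exact weakLE_mul_absorb cs _ _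

end Coxeter

section Finite

variable [Finite M.Group]

theorem atom_mul_left_cancel {s : B} {g h : PosArtin M} (e : atom M s * g = atom M s * h) :
    g = h := by
  let cs := M.toCoxeterSystem
  have key : ∀ g : PosArtin M,
      canon cs ((cs.simple s)⁻¹ * (normalForm cs (atom M s * g)).1) *
        (normalForm cs (atom M s * g)).2 = g := by
    intro g
    rw [normalForm_atom_mul, push_apply, inv_mul_cancel_left, ← mul_assoc,
      canon_mul_canon_inv_mul cs (absorb_weakLE cs _ _), canon_mul_normalForm]
  rw [← key g, e, key h]

theorem left_cancel {f g h : PosArtin M} (e : f * g = f * h) :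
    g = h := by
  obtain ⟨ω, rfl⟩ := exists_word M f
  induction ω with
  | nil => simpa using e
  | cons s ω ih =>
    rw [word_cons, mul_assoc, mul_assoc] at e
    exact ih (atom_mul_left_cancel e)

theorem word_altList_dvd {s t : B} (hst : s ≠ t) {g : PosArtin M} (hs : atom M s ∣ g)
    (ht : atom M t ∣ g) : M s t ≠ 0 ∧ word M (altList s t (M s t)) ∣ g := by
  let cs := M.toCoxeterSystem
  have hs' := isLeftDescent_normalForm cs hs
  have ht' := isLeftDescent_normalForm cs ht
  refine ⟨coxeterMatrix_ne_zero_of_isLeftDescent cs hst hs' ht', ?_⟩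
  rw [← canon_wordProd cs (isReduced_altList cs hst (Or.inr le_rfl))]
  conv_rhs => rw [← canon_mul_normalForm cs g]
  rw [← canon_mul_canon_inv_mul cs (weakLE_altList cs hst hs' ht'), mul_assoc]
  exact Dvd.intro _ rfl

/-- The lift of the longest element is right-divisible by every atom and quasi-central. -/
theorem exists_fundamental : ∃ δ : PosArtin M, ∀ s,
    (∃ c, δ = c * atom M s) ∧ ∃ s', δ * atom M s = atom M s' * δ := by
  let cs := M.toCoxeterSystem
  obtain ⟨w₀, hw₀⟩ := exists_longest cs
  refine ⟨canon cs w₀, fun s => ?_⟩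
  have hinv : w₀⁻¹ = w₀ := by
    have h := hw₀ w₀
    rw [Nat.add_eq_right, cs.length_eq_zero_iff] at h
    exact inv_eq_of_mul_eq_one_left h
  have hr : ∀ x : M.Group, cs.length (w₀ * x) + cs.length x = cs.length w₀ := by
    intro x
    have h := hw₀ x⁻¹
    rwa [cs.length_inv, ← cs.length_inv, mul_inv_rev, inv_inv, hinv] at h
  have h₁ := hr (cs.simple s)
  have h₂ := hw₀ (w₀ * cs.simple s)
  rw [cs.length_simple] at h₁
  obtain ⟨s', hs'⟩ := cs.length_eq_one_iff.1
    (show cs.length (w₀ * cs.simple s * w₀) = 1 by omega)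
  have he : cs.simple s' * w₀ = w₀ * cs.simple s := by
    nth_rewrite 1 [← hs', ← hinv]
    rw [hinv, mul_assoc]
    nth_rewrite 3 [← hinv]
    rw [mul_inv_cancel, mul_one]
  have h₃ : canon cs w₀ = canon cs (w₀ * cs.simple s) * atom M s := by
    rw [← canon_simple cs s, ← canon_mul, cs.simple_mul_simple_cancel_right]
    rw [weakLE_mul_iff, cs.simple_mul_simple_cancel_right, cs.length_simple, h₁]
  have h₄ : canon cs w₀ = atom M s' * canon cs (w₀ * cs.simple s) := by
    rw [← canon_simple cs s', ← canon_mul, ← he, cs.simple_mul_simple_cancel_left]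
    rw [weakLE_mul_iff, ← he, cs.simple_mul_simple_cancel_left, cs.length_simple, he, add_comm, h₁]
  refine ⟨⟨_, h₃⟩, s', ?_⟩
  nth_rewrite 1 [h₄]
  rw [mul_assoc, ← h₃]

end Finite

/-! ### Reversal -/

theorem reverse_altList_two_mul_add_one (s t : B) (n : ℕ) :
    (altList s t (2 * n + 1)).reverse = altList s t (2 * n + 1) := by
  rw [altList, reverse_cons, reverse_altList_two_mul]
  induction n with
  | zero => rfl
  | succ n ih => rw [Nat.mul_succ, altList, altList, cons_append, cons_append, ih, altList, altList]

theorem word_reverse_altList_comm (s t : B) :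
    word M (altList s t (M s t)).reverse = word M (altList t s (M s t)).reverse := by
  rcases Nat.even_or_odd' (M s t) with ⟨n, h | h⟩
  · rw [h, reverse_altList_two_mul, reverse_altList_two_mul, ← h, word_altList_comm]
  · rw [h, reverse_altList_two_mul_add_one, reverse_altList_two_mul_add_one, ← h,
      word_altList_comm]

/-- The reversal anti-automorphism, as a homomorphism to the opposite monoid. -/
def revHom (M : CoxeterMatrix B) : PosArtin M →* (PosArtin M)ᵐᵒᵖ :=
  lift (fun s => MulOpposite.op (atom M s)) (by
    have key : ∀ ω : List B, (ω.map (fun s => MulOpposite.op (atom M s))).prod =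
        MulOpposite.op (word M ω.reverse) := by
      intro ω
      induction ω with
      | nil => rfl
      | cons s ω ih =>
        rw [map_cons, prod_cons, ih, reverse_cons, word_append, word_singleton, MulOpposite.op_mul]
    intro s t _ _
    rw [key, key, word_reverse_altList_comm])

/-- The reversal anti-automorphism. -/
def rev (p : PosArtin M) : PosArtin M := (revHom M p).unop

@[simp]
theorem rev_one : rev (1 : PosArtin M) = 1 := by
  simp [rev]

@[simp]
theorem rev_mul (p q : PosArtin M) : rev (p * q) = rev q * rev p := by
  simp [rev]

@[simp]
theorem rev_atom (s : B) : rev (atom M s) = atom M s := rfl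

theorem rev_word (ω : List B) : rev (word M ω) = word M ω.reverse := by
  induction ω with
  | nil => simp
  | cons s ω ih => rw [word_cons, rev_mul, ih, reverse_cons, word_append, rev_atom, word_singleton]

@[simp]
theorem rev_rev (p : PosArtin M) : rev (rev p) = p := by
  obtain ⟨ω, rfl⟩ := exists_word M p
  rw [rev_word, rev_word, reverse_reverse]

theorem rev_dvd_rev_iff {p q : PosArtin M} : rev p ∣ rev q ↔ ∃ c, q = c * p := by
  constructor
  · rintro ⟨c, hc⟩
    exact ⟨rev c, by rw [← rev_rev q, hc, rev_mul, rev_rev]⟩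
  · rintro ⟨c, rfl⟩
    exact ⟨rev c, rev_mul c p⟩

/-! ### Length and support -/

/-- The length homomorphism. -/
def lenHom (M : CoxeterMatrix B) : PosArtin M →* Multiplicative ℕ :=
  lift (fun _ => Multiplicative.ofAdd 1) (by
    intro s t _ _
    simp [map_const', length_altList])

/-- The length of an element of `PosArtin M`. -/
def length (p : PosArtin M) : ℕ := (lenHom M p).toAdd

theorem length_mul (p q : PosArtin M) : length (p * q) = length p + length q := by
  simp [length]

theorem length_word (ω : List B) : length (word M ω) = ω.length := by
  rw [length, lenHom, lift_word]
  simp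

theorem length_atom (s : B) : length (atom M s) = 1 := rfl

theorem length_rev (p : PosArtin M) : length (rev p) = length p := by
  obtain ⟨ω, rfl⟩ := exists_word M p
  rw [rev_word, length_word, length_word, length_reverse]

theorem eq_one_of_length_eq_zero {p : PosArtin M} (h : length p = 0) : p = 1 := by
  obtain ⟨ω, rfl⟩ := exists_word M p
  rw [length_word, length_eq_zero_iff] at h
  rw [h, word_nil]

theorem exists_atom_of_length_eq_one {p : PosArtin M} (h : length p = 1) : ∃ s, p = atom M s := by
  obtain ⟨ω, rfl⟩ := exists_word M p
  rw [length_word, length_eq_one_iff] at h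
  obtain ⟨s, rfl⟩ := h
  exact ⟨s, word_singleton M s⟩

theorem eq_or_length_lt_of_dvd {p q : PosArtin M} (h : p ∣ q) : p = q ∨ length p < length q := by
  obtain ⟨c, rfl⟩ := h
  rw [length_mul]
  rcases Nat.eq_zero_or_pos (length c) with hc | hc
  · left
    rw [eq_one_of_length_eq_zero hc, mul_one]
  · right
    omega

/-- The submonoid of `PosArtin M` generated by a set of atoms. -/
def on (M : CoxeterMatrix B) (Z : Set B) : Submonoid (PosArtin M) :=
  Submonoid.closure (atom M '' Z)

theorem prod_map_altList_of_idempotent {N : Type*} [CommMonoid N] {f : B → N}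
    (hf : ∀ s, f s * f s = f s) (s t : B) (n : ℕ) :
    ((altList s t (n + 2)).map f).prod = f s * f t := by
  induction n generalizing s t with
  | zero => simp [altList]
  | succ n ih => rw [altList, map_cons, prod_cons, ih, mul_left_comm, hf, mul_comm]

open Classical in
/-- The homomorphism detecting whether an element lies in `on M Z`. -/
noncomputable def supportHom (M : CoxeterMatrix B) (Z : Set B) : PosArtin M →* ℕ :=
  lift (fun s => if s ∈ Z then 1 else 0) (by
    intro s t hst h0
    have h1 := M.off_diagonal s t hst
    obtain ⟨n, hn⟩ := Nat.exists_eq_add_of_le' (show 2 ≤ M s t by omega)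
    rw [hn, prod_map_altList_of_idempotent (by simp), prod_map_altList_of_idempotent (by simp),
      mul_comm])

theorem mem_on_iff {Z : Set B} {p : PosArtin M} : p ∈ on M Z ↔ supportHom M Z p = 1 := by
  constructor
  · intro h
    induction h using Submonoid.closure_induction with
    | mem x hx =>
      obtain ⟨s, hs, rfl⟩ := hx
      simp [supportHom, hs]
    | one => simp
    | mul x y _ _ hx hy => rw [map_mul, hx, hy]
  · intro h
    obtain ⟨ω, rfl⟩ := exists_word M p
    induction ω with
    | nil => exact one_mem _
    | cons s ω ih =>
      rw [word_cons, map_mul, mul_eq_one] at h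
      rw [word_cons]
      refine mul_mem (Submonoid.subset_closure ⟨s, ?_, rfl⟩) (ih h.2)
      by_contra hs
      simp [supportHom, hs] at h

theorem mul_mem_on_iff {Z : Set B} {p q : PosArtin M} :
    p * q ∈ on M Z ↔ p ∈ on M Z ∧ q ∈ on M Z := by
  rw [mem_on_iff, mem_on_iff, mem_on_iff, map_mul, mul_eq_one]

theorem atom_mem_on_iff {Z : Set B} {s : B} : atom M s ∈ on M Z ↔ s ∈ Z := by
  rw [mem_on_iff]
  simp [supportHom]

theorem atom_injective : Function.Injective (atom M) := by
  intro s t h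
  have : atom M s ∈ on M {s} := atom_mem_on_iff.2 rfl
  rw [h, atom_mem_on_iff] at this
  exact this.symm

theorem rev_mem_on {Z : Set B} {p : PosArtin M} (h : p ∈ on M Z) : rev p ∈ on M Z := by
  induction h using Submonoid.closure_induction with
  | mem x hx =>
    obtain ⟨s, hs, rfl⟩ := hx
    exact atom_mem_on_iff.2 hs
  | one => simp
  | mul x y _ _ hx hy =>
    rw [rev_mul]
    exact mul_mem hy hx

/-! ### Cancellation, and the embedding into the group -/

section Finite

variable [Finite M.Group]

instance : IsCancelMul (PosArtin M) where
  mul_left_cancel _ _ _ h := left_cancel h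
  mul_right_cancel p q r h := by
    have := congrArg rev h
    simp only [rev_mul] at this
    rw [← rev_rev q, left_cancel this, rev_rev]

/-- A right version of `word_altList_dvd`. -/
theorem exists_eq_mul_word_reverse {s t : B} (hst : s ≠ t) {g : PosArtin M}
    (hs : ∃ c, g = c * atom M s) (ht : ∃ c, g = c * atom M t) :
    M s t ≠ 0 ∧ ∃ c, g = c * word M (altList s t (M s t)).reverse := by
  rw [← rev_dvd_rev_iff] at hs ht
  obtain ⟨hm, h⟩ := word_altList_dvd hst hs ht
  refine ⟨hm, ?_⟩
  rwa [← rev_rev (word M (altList s t (M s t))), rev_dvd_rev_iff, rev_word] at h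

theorem exists_common_left_multiple (p q : PosArtin M) : ∃ a b : PosArtin M, a * p = b * q := by
  obtain ⟨δ, hδ⟩ := exists_fundamental (M := M)
  have hcomm : ∀ p : PosArtin M, ∃ p', δ * p = p' * δ := by
    intro p
    obtain ⟨ω, rfl⟩ := exists_word M p
    induction ω with
    | nil => exact ⟨1, by simp⟩
    | cons s ω ih =>
      obtain ⟨p', hp'⟩ := ih
      obtain ⟨s', hs'⟩ := (hδ s).2
      exact ⟨atom M s' * p', by rw [word_cons, ← mul_assoc, hs', mul_assoc, hp', mul_assoc]⟩
  have hcomm' : ∀ (n : ℕ) (p : PosArtin M), ∃ p', δ ^ n * p = p' * δ ^ n := by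
    intro n
    induction n with
    | zero => exact fun p => ⟨p, by simp⟩
    | succ n ih =>
      intro p
      obtain ⟨p', hp'⟩ := hcomm p
      obtain ⟨p'', hp''⟩ := ih p'
      exact ⟨p'', by rw [pow_succ, mul_assoc, hp', ← mul_assoc, hp'', mul_assoc]⟩
  have hdvd : ∀ p : PosArtin M, ∃ (n : ℕ) (q : PosArtin M), δ ^ n = q * p := by
    intro p
    obtain ⟨ω, rfl⟩ := exists_word M p
    induction ω using List.reverseRecOn with
    | nil => exact ⟨0, 1, by simp⟩
    | append_singleton ω s ih =>
      obtain ⟨n, q, hq⟩ := ih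
      obtain ⟨y, hy⟩ := (hδ s).1
      obtain ⟨y', hy'⟩ := hcomm' n y
      refine ⟨n + 1, y' * q, ?_⟩
      rw [pow_succ]
      nth_rewrite 2 [hy]
      rw [← mul_assoc, hy', hq, word_append, word_singleton]
      simp only [mul_assoc]
  obtain ⟨n, a, ha⟩ := hdvd p
  obtain ⟨m, b, hb⟩ := hdvd q
  exact ⟨δ ^ m * a, δ ^ n * b, by
    rw [mul_assoc, mul_assoc, ← ha, ← hb, ← pow_add, ← pow_add, add_comm]⟩

end Finite

/-- The canonical homomorphism from the abstract positive monoid to the Artin-Tits group. -/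
def toArtin (M : CoxeterMatrix B) : PosArtin M →* Artin M :=
  lift (gen M) (by
    intro s t hst h0
    have h : PresentedGroup.mk (braidRels M) _ = 1 :=
      PresentedGroup.one_of_mem (rels := braidRels M) ⟨s, t, hst, h0, rfl⟩
    rw [map_mul, map_inv, mul_inv_eq_one, map_list_prod, map_list_prod, map_map, map_map] at h
    exact h)

@[simp]
theorem toArtin_atom (s : B) : toArtin M (atom M s) = gen M s := rfl

theorem toArtin_injective [Finite M.Group] : Function.Injective (toArtin M) := by
  let _ : OreLocalization.OreSet (⊤ : Submonoid (PosArtin M)) :=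
    { ore_right_cancel := fun a b s h => ⟨1, by rw [mul_right_cancel h]⟩
      oreNum := fun r s => (exists_common_left_multiple r (s : PosArtin M)).choose_spec.choose
      oreDenom := fun r s =>
        ⟨(exists_common_left_multiple r (s : PosArtin M)).choose, Submonoid.mem_top _⟩
      ore_eq := fun r s =>
        (exists_common_left_multiple r (s : PosArtin M)).choose_spec.choose_spec }
  let u : PosArtin M → (OreLocalization (⊤ : Submonoid (PosArtin M)) (PosArtin M))ˣ :=
    fun p => OreLocalization.numeratorUnit ⟨p, Submonoid.mem_top _⟩
  have hu : ∀ ω : List B, ((ω.map (fun s => u (atom M s))).prod : (OreLocalization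
      (⊤ : Submonoid (PosArtin M)) (PosArtin M))) = OreLocalization.numeratorHom (word M ω) := by
    intro ω
    induction ω with
    | nil => rw [word_nil, map_one]; rfl
    | cons s ω ih =>
      rw [map_cons, prod_cons, Units.val_mul, ih, word_cons, map_mul]
      rfl
  have hrel : ∀ r ∈ braidRels M, FreeGroup.lift (fun s => u (atom M s)) r = 1 := by
    rintro r ⟨s, t, hst, h0, rfl⟩
    rw [map_mul, map_inv, mul_inv_eq_one, map_list_prod, map_list_prod, map_map, map_map]
    ext
    have h1 := hu (altList s t (M s t))
    have h2 := hu (altList t s (M s t))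
    rw [word_altList_comm, ← h2] at h1
    simpa [Function.comp_def] using h1
  let φ : Artin M →* (OreLocalization (⊤ : Submonoid (PosArtin M)) (PosArtin M))ˣ :=
    PresentedGroup.toGroup hrel
  have hgen : ∀ s, φ (gen M s) = u (atom M s) := fun s => PresentedGroup.toGroup.of hrel
  have hfac : ∀ p : PosArtin M, (φ (toArtin M p) : OreLocalization
      (⊤ : Submonoid (PosArtin M)) (PosArtin M)) = OreLocalization.numeratorHom p := by
    intro p
    obtain ⟨ω, rfl⟩ := exists_word M p
    induction ω with
    | nil => rw [word_nil, map_one, map_one, map_one]; rfl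
    | cons s ω ih =>
      rw [word_cons, map_mul, map_mul, map_mul, Units.val_mul, ih, toArtin_atom, hgen]
      rfl
  intro p q h
  have h' : OreLocalization.numeratorHom (S := (⊤ : Submonoid (PosArtin M))) p =
      OreLocalization.numeratorHom q := by
    rw [← hfac, h, hfac]
  rw [OreLocalization.numeratorHom_apply, OreLocalization.numeratorHom_apply,
    OreLocalization.oreDiv_eq_iff] at h'
  obtain ⟨a, b, h₁, h₂⟩ := h'
  have h₃ : (a : PosArtin M) * q = b * p := h₁
  rw [OneMemClass.coe_one, mul_one, mul_one] at h₂
  rw [h₂] at h₃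
  exact (mul_left_cancel h₃).symm

theorem mem_posMon_iff {g : Artin M} : g ∈ posMon M ↔ ∃ p, toArtin M p = g := by
  have h : MonoidHom.mrange (toArtin M) = posMon M := by
    rw [MonoidHom.mrange_eq_map, ← PresentedMonoid.closure_range_of, MonoidHom.map_mclosure,
      posMon, ← Set.range_comp]
    rfl
  rw [← h, MonoidHom.mem_mrange]

theorem mem_posMonOn_iff {Z : Set B} {g : Artin M} :
    g ∈ posMonOn M Z ↔ ∃ p ∈ on M Z, toArtin M p = g := by
  have h : (on M Z).map (toArtin M) = posMonOn M Z := by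
    rw [on, MonoidHom.map_mclosure, posMonOn, ← Set.image_comp]
    rfl
  rw [← h, Submonoid.mem_map]

/-! ### The elements `Δ` -/

theorem word_altList_dvd_succ (s t : B) (n : ℕ) :
    word M (altList s t n) ∣ word M (altList s t (n + 1)) := by
  induction n generalizing s t with
  | zero => exact one_dvd _
  | succ n ih =>
    rw [altList, altList, word_cons, word_cons]
    exact mul_dvd_mul_left _ (ih t s)

/-- `δ` is the least common multiple of the atoms of `Z` in `on M Z`. -/
structure IsDelta (Z : Set B) (δ : PosArtin M) : Prop where
  mem : δ ∈ on M Z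
  atom_dvd : ∀ s ∈ Z, atom M s ∣ δ
  dvd_of_mem : ∀ m ∈ on M Z, (∀ s ∈ Z, atom M s ∣ m) → δ ∣ m

theorem atom_dvd_word_altList {s t : B} (h : M s t ≠ 0) :
    atom M s ∣ word M (altList s t (M s t)) := by
  obtain ⟨m, hm⟩ := Nat.exists_eq_succ_of_ne_zero h
  rw [hm, Nat.succ_eq_add_one, altList, word_cons]
  exact dvd_mul_right _ _

theorem exists_eq_atom_mul_of_dvd {y z : PosArtin M} (h : y ∣ z) (hne : y ≠ z) :
    ∃ s, y * atom M s ∣ z := by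
  obtain ⟨c, rfl⟩ := h
  obtain ⟨ω, rfl⟩ := exists_word M c
  cases ω with
  | nil => simp at hne
  | cons s ω => exact ⟨s, by rw [word_cons, ← mul_assoc]; exact dvd_mul_right _ _⟩

variable [Finite M.Group]

theorem mul_word_altList_dvd {s t : B} (hst : s ≠ t) {y z : PosArtin M}
    (hs : y * atom M s ∣ z) (ht : y * atom M t ∣ z) :
    M s t ≠ 0 ∧ y * word M (altList s t (M s t)) ∣ z := by
  obtain ⟨c, rfl⟩ := (dvd_mul_right _ _).trans hs
  have cancel : ∀ {a b : PosArtin M}, y * a ∣ y * b → a ∣ b := by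
    rintro a b ⟨d, hd⟩
    rw [mul_assoc] at hd
    exact ⟨d, mul_left_cancel hd⟩
  obtain ⟨hm, h⟩ := word_altList_dvd hst (cancel hs) (cancel ht)
  exact ⟨hm, mul_dvd_mul_left _ h⟩

theorem exists_gcd (p q : PosArtin M) :
    ∃ g, (g ∣ p ∧ g ∣ q) ∧ ∀ x, x ∣ p → x ∣ q → x ∣ g := by
  obtain ⟨g, hg, hmax⟩ := exists_greatest_of_local_join (T := PosArtin M) (· ∣ ·) dvd_refl
    (fun _ _ _ => dvd_trans) length {x | x ∣ p ∧ x ∣ q} (length p)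
    (fun x hx => by
      rcases eq_or_length_lt_of_dvd hx.1 with rfl | h
      · exact le_rfl
      · exact h.le) 1 ⟨one_dvd _, one_dvd _⟩ (fun _ _ => one_dvd _)
    (fun _ _ => eq_or_length_lt_of_dvd) (by
      intro y hy z₁ h₁ z₂ h₂ hy₁ hy₂ hne₁ hne₂
      obtain ⟨s, hs⟩ := exists_eq_atom_mul_of_dvd hy₁ hne₁
      obtain ⟨t, ht⟩ := exists_eq_atom_mul_of_dvd hy₂ hne₂
      have hne : ∀ s, y ≠ y * atom M s := fun s h => by
        have := congrArg length h
        rw [length_mul, length_atom] at this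
        omega
      refine ⟨y * atom M s, ⟨hs.trans h₁.1, hs.trans h₁.2⟩, y * atom M t,
        ⟨ht.trans h₂.1, ht.trans h₂.2⟩, ?_⟩
      rcases eq_or_ne s t with rfl | hst
      · exact ⟨y * atom M s, ⟨hs.trans h₁.1, hs.trans h₁.2⟩, dvd_mul_right _ _, hne s,
          dvd_mul_right _ _, hne s, hs, ht, dvd_rfl, dvd_rfl⟩
      · have hp := mul_word_altList_dvd hst (hs.trans h₁.1) (ht.trans h₂.1)
        have hq := mul_word_altList_dvd hst (hs.trans h₁.2) (ht.trans h₂.2)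
        refine ⟨y * word M (altList s t (M s t)), ⟨hp.2, hq.2⟩, dvd_mul_right _ _, hne s,
          dvd_mul_right _ _, hne t, hs, ht, mul_dvd_mul_left _ (atom_dvd_word_altList hp.1),
          mul_dvd_mul_left _ ?_⟩
        have := atom_dvd_word_altList (M := M) (s := t) (t := s) (M.symmetric s t ▸ hp.1)
        rwa [word_altList_comm, M.symmetric t s] at this)
  exact ⟨g, hg, fun x h h' => hmax x ⟨h, h'⟩⟩

namespace IsDelta

variable {Z : Set B} {δ : PosArtin M}

/-- `Δ` left-divides every common multiple of the atoms in the whole monoid. -/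
theorem dvd (hδ : IsDelta Z δ) {g : PosArtin M} (h : ∀ s ∈ Z, atom M s ∣ g) : δ ∣ g := by
  obtain ⟨y, ⟨hyδ, hyg⟩, hy⟩ := exists_gcd δ g
  have hmem : y ∈ on M Z := by
    obtain ⟨c, hc⟩ := hyδ
    have := hδ.mem
    rw [hc, mul_mem_on_iff] at this
    exact this.1
  exact (hδ.dvd_of_mem y hmem fun s hs => hy _ (hδ.atom_dvd s hs) (h s hs)).trans hyg

theorem atom_dvd_atom_mul (hδ : IsDelta Z δ) {a b : B} (ha : a ∈ Z) (hb : b ∈ Z) :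
    atom M b ∣ atom M a * δ := by
  rcases eq_or_ne a b with rfl | hab
  · exact dvd_mul_right _ _
  obtain ⟨hm, h⟩ := word_altList_dvd hab (hδ.atom_dvd a ha) (hδ.atom_dvd b hb)
  have hb' : atom M b ∣ word M (altList a b (M a b)) := by
    rw [word_altList_comm, M.symmetric a b]
    exact atom_dvd_word_altList (M.symmetric a b ▸ hm)
  refine hb'.trans ?_
  rw [word_altList_comm] at h
  obtain ⟨m, hm'⟩ := Nat.exists_eq_succ_of_ne_zero hm
  rw [hm', Nat.succ_eq_add_one] at h ⊢
  rw [altList, word_cons]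
  exact mul_dvd_mul_left _ ((word_altList_dvd_succ b a m).trans h)

theorem exists_mul_atom [Finite B] (hδ : IsDelta Z δ) {b : B} (hb : b ∈ Z) :
    ∃ c, δ = c * atom M b := by
  have key : ∀ a : Z, ∃ b : Z, atom M a * δ = δ * atom M b := by
    rintro ⟨a, ha⟩
    obtain ⟨x, hx⟩ := hδ.dvd_of_mem (atom M a * δ) (mul_mem (atom_mem_on_iff.2 ha) hδ.mem)
      fun b hb => hδ.atom_dvd_atom_mul ha hb
    have hl := congrArg length hx
    rw [length_mul, length_mul, length_atom, add_comm, add_right_inj] at hl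
    obtain ⟨b, rfl⟩ := exists_atom_of_length_eq_one hl.symm
    have hmem : δ * atom M b ∈ on M Z := hx ▸ mul_mem (atom_mem_on_iff.2 ha) hδ.mem
    exact ⟨⟨b, atom_mem_on_iff.1 (mul_mem_on_iff.1 hmem).2⟩, hx⟩
  choose σ hσ using key
  have hinj : Function.Injective σ := by
    intro a a' h
    have := (hσ a).trans (h ▸ (hσ a').symm)
    exact Subtype.ext (atom_injective (mul_right_cancel this))
  obtain ⟨a, ha⟩ := Finite.injective_iff_surjective.1 hinj ⟨b, hb⟩
  obtain ⟨c, hc⟩ := hδ.atom_dvd a a.2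
  refine ⟨c, mul_left_cancel (a := atom M (a : B)) ?_⟩
  rw [hσ, ha, ← mul_assoc, ← hc]

theorem rev_eq [Finite B] (hδ : IsDelta Z δ) : rev δ = δ := by
  have h : δ ∣ rev δ := hδ.dvd_of_mem _ (rev_mem_on hδ.mem) fun s hs => by
    rw [← rev_atom, rev_dvd_rev_iff]
    exact hδ.exists_mul_atom hs
  rcases eq_or_length_lt_of_dvd h with h | h
  · exact h.symm
  · rw [length_rev] at h
    exact absurd h (lt_irrefl _)

/-- `Δ` right-divides every common left multiple of the atoms in the whole monoid. -/
theorem exists_eq_mul [Finite B] (hδ : IsDelta Z δ) {g : PosArtin M}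
    (h : ∀ s ∈ Z, ∃ c, g = c * atom M s) : ∃ c, g = c * δ := by
  rw [← rev_dvd_rev_iff, hδ.rev_eq]
  refine hδ.dvd fun s hs => ?_
  rw [← rev_atom, rev_dvd_rev_iff]
  exact h s hs

end IsDelta

theorem exists_isDelta {Z : Set B} {d : Artin M} (hd : ArtinTitsPaper.IsDelta M Z d) :
    ∃ δ : PosArtin M, IsDelta Z δ ∧ toArtin M δ = d := by
  obtain ⟨hmem, hdvd, hmin⟩ := hd
  obtain ⟨δ, hδ, rfl⟩ := mem_posMonOn_iff.1 hmem
  refine ⟨δ, ⟨hδ, fun s hs => ?_, fun m hm h => ?_⟩, rfl⟩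
  · obtain ⟨c, hc, he⟩ := hdvd s hs
    obtain ⟨p, -, rfl⟩ := mem_posMonOn_iff.1 hc
    rw [← toArtin_atom, ← map_mul] at he
    exact ⟨p, (toArtin_injective he).symm⟩
  · obtain ⟨c, hc, he⟩ := hmin (toArtin M m) (mem_posMonOn_iff.2 ⟨m, hm, rfl⟩) (by
      intro s hs
      obtain ⟨c, rfl⟩ := h s hs
      exact ⟨toArtin M c, mem_posMonOn_iff.2 ⟨c, (mul_mem_on_iff.1 hm).2, rfl⟩, by
        rw [map_mul, toArtin_atom]⟩)
    obtain ⟨p, -, rfl⟩ := mem_posMonOn_iff.1 hc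
    rw [← map_mul] at he
    exact ⟨p, (toArtin_injective he).symm⟩

theorem rdvd_toArtin_iff {p q : PosArtin M} :
    rdvd M (toArtin M p) (toArtin M q) ↔ ∃ c, q = c * p := by
  constructor
  · rintro ⟨c, hc, he⟩
    obtain ⟨c, rfl⟩ := mem_posMon_iff.1 hc
    rw [← map_mul] at he
    exact ⟨c, (toArtin_injective he).symm⟩
  · rintro ⟨c, rfl⟩
    exact ⟨toArtin M c, mem_posMon_iff.2 ⟨c, rfl⟩, (map_mul _ _ _).symm⟩

/-- If `p` conjugates `s` and `t` to atoms, right divisibility of `p` by `t` propagates to `s`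
along an edge of the Coxeter diagram. -/
theorem exists_eq_mul_atom_of_ne_two {p : PosArtin M} {s t s' t' : B} (hst : s ≠ t)
    (hm : M s t ≠ 2) (hs : p * atom M s = atom M s' * p) (ht : p * atom M t = atom M t' * p)
    (hp : ∃ c, p = c * atom M t) : ∃ c, p = c * atom M s := by
  obtain ⟨q, hq⟩ := hp
  obtain ⟨h0, k, hk⟩ := exists_eq_mul_word_reverse hst (g := p * atom M s) ⟨p, rfl⟩
    ⟨atom M s' * q, by rw [hs, mul_assoc, ← hq]⟩
  have h1 := M.off_diagonal s t hst
  obtain ⟨n, hn⟩ := Nat.exists_eq_add_of_le' (show 3 ≤ M s t by omega)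
  rw [hn, altList, altList, altList, reverse_cons, reverse_cons, reverse_cons, word_append,
    word_append, word_append, word_singleton, word_singleton, ← mul_assoc, ← mul_assoc,
    ← mul_assoc] at hk
  have hk' := mul_right_cancel hk
  refine ⟨atom M t' * (k * word M (altList t s n).reverse), mul_right_cancel (b := atom M t) ?_⟩
  rw [ht, hk']
  simp only [mul_assoc]

end PosArtin

/-! ### Ribbons -/

theorem IsElemRibbon.mem_posMon [Finite B] {M : CoxeterMatrix B} [Finite M.Group]
    {X Y : Set B} {g : Artin M} (hg : IsElemRibbon M X Y g) : g ∈ posMon M := by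
  obtain ⟨t, -, h, -⟩ := hg
  rcases h with ⟨-, hd⟩ | ⟨-, d₁, d₂, hd₁, hd₂, rfl⟩
  · obtain ⟨δ, -, rfl⟩ := PosArtin.exists_isDelta hd
    exact PosArtin.mem_posMon_iff.2 ⟨δ, rfl⟩
  · obtain ⟨δ₁, h₁, rfl⟩ := PosArtin.exists_isDelta hd₁
    obtain ⟨δ₂, h₂, rfl⟩ := PosArtin.exists_isDelta hd₂
    obtain ⟨c, rfl⟩ := h₂.exists_eq_mul fun s hs => h₁.exists_mul_atom hs.1
    exact PosArtin.mem_posMon_iff.2 ⟨c, by rw [map_mul, mul_inv_cancel_right]⟩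

theorem IsRibbon.mem_posMon [Finite B] {M : CoxeterMatrix B} [Finite M.Group]
    {X Y : Set B} {g : Artin M} (hg : IsRibbon M X Y g) : g ∈ posMon M := by
  induction hg with
  | nil => exact one_mem _
  | cons _ h ih => exact mul_mem h.mem_posMon ih

theorem IsRibbon.exists_mul_gen_eq {M : CoxeterMatrix B} {X Y : Set B} {g : Artin M}
    (hg : IsRibbon M X Y g) {s : B} (hs : s ∈ X) : ∃ s' ∈ Y, g * gen M s = gen M s' * g := by
  induction hg with
  | nil => exact ⟨s, hs, by rw [one_mul, mul_one]⟩
  | @cons Y Z g h _ hh ih =>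
    obtain ⟨s', hs', he⟩ := ih
    obtain ⟨-, -, -, -, hconj⟩ := hh
    obtain ⟨s'', hs'', he'⟩ : h * gen M s' ∈ leftMul M Z h := hconj ▸ ⟨s', hs', rfl⟩
    exact ⟨s'', hs'', by rw [mul_assoc, he, ← mul_assoc, ← he', mul_assoc]⟩

/-- **Lemma (Godelle).** In a spherical-type Artin-Tits system, if `X` is indecomposable,
`t ∈ X` and `g` is a positive `Y`-ribbon-`X` right-divisible by `t`, then `g` is
right-divisible by `Δ_X`. -/
theorem ribbon_rdvd_delta
    [Finite B] (M : CoxeterMatrix B) (hsph : Finite M.Group)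
    (X : Set B) (hind : Indecomp M X) (t : B) (ht : t ∈ X)
    (Y : Set B) (g : Artin M) (hg : IsRibbon M X Y g)
    (hdvd : rdvd M (gen M t) g)
    (Δ : Artin M) (hΔ : IsDelta M X Δ) :
    rdvd M Δ g := by
  obtain ⟨p, rfl⟩ := PosArtin.mem_posMon_iff.1 hg.mem_posMon
  obtain ⟨δ, hδ, rfl⟩ := PosArtin.exists_isDelta hΔ
  rw [← PosArtin.toArtin_atom, PosArtin.rdvd_toArtin_iff] at hdvd
  rw [PosArtin.rdvd_toArtin_iff]
  refine hδ.exists_eq_mul ?_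
  have hconj : ∀ s ∈ X, ∃ s', p * PosArtin.atom M s = PosArtin.atom M s' * p := by
    intro s hs
    obtain ⟨s', -, h⟩ := hg.exists_mul_gen_eq hs
    rw [← PosArtin.toArtin_atom, ← PosArtin.toArtin_atom, ← map_mul, ← map_mul] at h
    exact ⟨s', PosArtin.toArtin_injective h⟩
  by_contra! hne
  obtain ⟨s, hs, hsp⟩ := hne
  refine hind ⟨{a ∈ X | ∃ c, p = c * PosArtin.atom M a},
    X \ {a ∈ X | ∃ c, p = c * PosArtin.atom M a}, ⟨t, ht, hdvd⟩,
    ⟨s, hs, fun h => by obtain ⟨c, hc⟩ := h.2; exact hsp c hc⟩,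
    Set.union_sdiff_cancel fun a ha => ha.1, Set.disjoint_sdiff_right, ?_⟩
  rintro a ⟨haX, ha⟩ b ⟨hbX, hb⟩
  by_contra hm
  obtain ⟨a', ha'⟩ := hconj a haX
  obtain ⟨b', hb'⟩ := hconj b hbX
  have hba : b ≠ a := by
    rintro rfl
    exact hb ⟨hbX, ha⟩
  exact hb ⟨hbX, PosArtin.exists_eq_mul_atom_of_ne_two hba (by rwa [M.symmetric]) hb' ha' ha⟩

end ArtinTitsPaper
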